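/- arXiv:2503.11107 — 13 statements merged into one kernel-verified Lean document; each statement's English description precedes it below -/
import Mathlib

section
/- Let m ≥ 1 and let A and B be finite multisets with all elements in {1,...,m}. If the sum of the elements of A is at least m² and the sum of the elements of B is at least m², then the pair (A,B) is reducible, i.e., there exist a nonempty sub-multiset A₀ of A and a nonempty sub-multiset B₀ of B whose element sums are equal. -/
/-- A pair `(A, B)` of multisets of naturals is *reducible* if there exist
nonempty sub-multisets `A₀ ≤ A` and `B₀ ≤ B` with equal element sums. -/
def Reducible (A B : Multiset ℕ) : Prop :=
  ∃ A₀ B₀ : Multiset ℕ, A₀ ≤ A ∧ B₀ ≤ B ∧ A₀ ≠ 0 ∧ B₀ ≠ 0 ∧ A₀.sum = B₀.sum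

theorem Reducible.symm {A B : Multiset ℕ} (h : Reducible A B) : Reducible B A := by
  obtain ⟨A₀, B₀, hA, hB, hA0, hB0, h⟩ := h
  exact ⟨B₀, A₀, hB, hA, hB0, hA0, h.symm⟩

theorem List.exists_sum_take_le_lt_add {m : ℕ} (hm : 1 ≤ m) (l : List ℕ) (hl : ∀ b ∈ l, b ≤ m)
    (x : ℕ) (hx : x ≤ l.sum) : ∃ j, (l.take j).sum ≤ x ∧ x < (l.take j).sum + m := by
  induction l generalizing x with
  | nil =>
    simp only [List.sum_nil] at hx
    exact ⟨0, by simp, by simp; omega⟩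
  | cons b l ih =>
    simp only [List.mem_cons, forall_eq_or_imp] at hl
    rw [List.sum_cons] at hx
    by_cases hxb : x < b
    · exact ⟨0, by simp, by simp; omega⟩
    · obtain ⟨j, h₁, h₂⟩ := ih hl.2 (x - b) (by omega)
      refine ⟨j + 1, ?_, ?_⟩ <;> rw [List.take_succ_cons, List.sum_cons] <;> omega

theorem List.sum_take_eq_add_sum_drop_take (l : List ℕ) {i k : ℕ} (h : i ≤ k) :
    (l.take k).sum = (l.take i).sum + ((l.take k).drop i).sum := by
  rw [← List.sum_take_add_sum_drop (l.take k) i, List.take_take, min_eq_left h]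

theorem List.sum_take_lt_sum_take {l : List ℕ} (hl : ∀ a ∈ l, 1 ≤ a) {i k : ℕ} (h : i < k)
    (hk : k ≤ l.length) : (l.take i).sum < (l.take k).sum := by
  rw [l.sum_take_eq_add_sum_drop_take h.le]
  have hpos : 0 < ((l.take k).drop i).sum := by
    refine List.sum_pos _ (fun a ha => hl a (List.mem_of_mem_take (List.mem_of_mem_drop ha))) ?_
    apply List.ne_nil_of_length_pos
    simp
    omega
  omega

theorem reducible_of_sum_le_of_le_card {m : ℕ} (hm : 1 ≤ m) {A B : Multiset ℕ}
    (hA : ∀ a ∈ A, 1 ≤ a) (hB : ∀ b ∈ B, b ≤ m) (hcard : m ≤ A.card) (hAB : A.sum ≤ B.sum) :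
    Reducible A B := by
  induction A using Quotient.inductionOn with | _ s
  induction B using Quotient.inductionOn with | _ t
  simp only [Multiset.quot_mk_to_coe, Multiset.mem_coe, Multiset.coe_card,
    Multiset.sum_coe] at *
  have hsum (i : ℕ) : (s.take i).sum ≤ t.sum := by
    have := List.sum_take_add_sum_drop s i
    omega
  choose j hj₁ hj₂ using fun i => t.exists_sum_take_le_lt_add hm hB _ (hsum i)
  obtain ⟨i, hi, k, hk, hik, heq⟩ := Finset.exists_ne_map_eq_of_card_lt_of_maps_to
    (s := Finset.range (s.length + 1)) (t := Finset.range m)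
    (f := fun i => (s.take i).sum - (t.take (j i)).sum) (by simp; omega)
    (fun i _ => by
      have h₁ := hj₁ i
      have h₂ := hj₂ i
      simp only [Finset.coe_range, Set.mem_Iio]
      omega)
  rw [Finset.mem_range] at hi hk
  wlog hlt : i < k generalizing i k
  · exact this k hk i hi hik.symm heq.symm (by omega)
  have hs := List.sum_take_lt_sum_take hA hlt (by omega)
  have hi₁ := hj₁ i
  have hk₁ := hj₁ k
  have hjlt : j i < j k := by
    by_contra! hle
    have := t.sum_take_eq_add_sum_drop_take hle
    omega
  have hs' := s.sum_take_eq_add_sum_drop_take hlt.le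
  have ht' := t.sum_take_eq_add_sum_drop_take hjlt.le
  refine ⟨((s.take k).drop i : List ℕ), ((t.take (j k)).drop (j i) : List ℕ),
    ((List.drop_sublist _ _).trans (List.take_sublist _ _)).subperm,
    ((List.drop_sublist _ _).trans (List.take_sublist _ _)).subperm, ?_, ?_, ?_⟩
  · intro h
    rw [Multiset.coe_eq_zero] at h
    rw [h, List.sum_nil] at hs'
    omega
  · intro h
    rw [Multiset.coe_eq_zero] at h
    rw [h, List.sum_nil] at ht'
    omega
  · rw [Multiset.sum_coe, Multiset.sum_coe]
    omega

theorem Multiset.le_card_of_sq_le_sum {m : ℕ} (hm : 1 ≤ m) {A : Multiset ℕ}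
    (hA : ∀ a ∈ A, a ≤ m) (hsum : m ^ 2 ≤ A.sum) : m ≤ A.card := by
  have h := Multiset.sum_le_card_nsmul A m hA
  rw [smul_eq_mul] at h
  exact Nat.le_of_mul_le_mul_right (by linarith [sq m]) hm

theorem reducible_of_sum_ge_sq (m : ℕ) (hm : 1 ≤ m) (A B : Multiset ℕ)
    (hA : ∀ a ∈ A, 1 ≤ a ∧ a ≤ m) (hB : ∀ b ∈ B, 1 ≤ b ∧ b ≤ m)
    (hAsum : m ^ 2 ≤ A.sum) (hBsum : m ^ 2 ≤ B.sum) :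
    Reducible A B := by
  rcases le_total A.sum B.sum with h | h
  · exact reducible_of_sum_le_of_le_card hm (fun a ha => (hA a ha).1) (fun b hb => (hB b hb).2)
      (Multiset.le_card_of_sq_le_sum hm (fun a ha => (hA a ha).2) hAsum) h
  · exact (reducible_of_sum_le_of_le_card hm (fun b hb => (hB b hb).1) (fun a ha => (hA a ha).2)
      (Multiset.le_card_of_sq_le_sum hm (fun b hb => (hB b hb).2) hBsum) h).symm
end

section
/- Let 0 ≤ k < n·m and let x be an optimal k-profile. Then there exists an optimal (k+1)-profile y such that diff(x,y) is irreducible. -/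
/-- `x` is a `k`-profile: each project gets between `0` and `m` efforts and the
total number of efforts is `k`. -/
def IsProfile (n m k : ℕ) (x : Fin n → ℕ) : Prop :=
  (∀ j, x j ≤ m) ∧ ∑ j, x j = k

/-- The revenue of a profile. -/
def revenue {n : ℕ} (R : Fin n → ℕ → ℝ) (x : Fin n → ℕ) : ℝ :=
  ∑ j, R j (x j)

/-- `x` is an optimal `k`-profile. -/
def IsOptimalProfile (n m k : ℕ) (R : Fin n → ℕ → ℝ) (x : Fin n → ℕ) : Prop :=
  IsProfile n m k x ∧ ∀ y, IsProfile n m k y → revenue R y ≤ revenue R x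

/-- The first component of `diff(x,y)`: the multiset `{y i - x i | y i > x i}`. -/
def diffA {n : ℕ} (x y : Fin n → ℕ) : Multiset ℕ :=
  (Finset.univ.filter fun i => x i < y i).val.map fun i => y i - x i

/-- The second component of `diff(x,y)`: the multiset `{x i - y i | x i > y i}`. -/
def diffB {n : ℕ} (x y : Fin n → ℕ) : Multiset ℕ :=
  (Finset.univ.filter fun i => y i < x i).val.map fun i => x i - y i

theorem Multiset.exists_le_map_eq_of_le_map {α β : Type*} {f : α → β} {s : Multiset α}
    {t : Multiset β} (h : t ≤ s.map f) : ∃ u ≤ s, u.map f = t := by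
  induction s using Quotient.inductionOn with
  | _ l =>
  induction t using Quotient.inductionOn with
  | _ r =>
  obtain ⟨r', hperm, hsub⟩ := Multiset.coe_le.1 h
  obtain ⟨l', hl', rfl⟩ := List.sublist_map_iff.1 hsub
  exact ⟨l', Multiset.coe_le.2 hl'.subperm, Multiset.coe_eq_coe.2 hperm⟩

theorem Finset.exists_subset_map_val_eq_of_le_map {α β : Type*} {f : α → β} {s : Finset α}
    {t : Multiset β} (h : t ≤ s.val.map f) : ∃ u ⊆ s, u.val.map f = t := by
  obtain ⟨u, hu, rfl⟩ := Multiset.exists_le_map_eq_of_le_map h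
  exact ⟨⟨u, Multiset.nodup_of_le hu s.nodup⟩, Finset.val_le_iff.1 hu, rfl⟩

/-- A reducible difference yields a nonempty set of coordinates, on all of which the two vectors
differ, over which they have the same sum. -/
theorem Reducible.exists_sum_eq {n : ℕ} {x y : Fin n → ℕ} (h : Reducible (diffA x y) (diffB x y)) :
    ∃ U : Finset (Fin n), U.Nonempty ∧ (∀ i ∈ U, x i ≠ y i) ∧ ∑ i ∈ U, x i = ∑ i ∈ U, y i := by
  obtain ⟨A₀, B₀, hA, hB, hA0, -, hsum⟩ := h
  obtain ⟨S, hS, rfl⟩ := Finset.exists_subset_map_val_eq_of_le_map hA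
  obtain ⟨T, hT, rfl⟩ := Finset.exists_subset_map_val_eq_of_le_map hB
  have hS' : ∀ i ∈ S, x i < y i := fun i hi => (Finset.mem_filter.1 (hS hi)).2
  have hT' : ∀ i ∈ T, y i < x i := fun i hi => (Finset.mem_filter.1 (hT hi)).2
  have hdisj : Disjoint S T :=
    Finset.disjoint_left.2 fun i hi hi' => (hS' i hi).asymm (hT' i hi')
  refine ⟨S ∪ T, ?_, ?_, ?_⟩
  · refine Finset.Nonempty.inl (Finset.nonempty_iff_ne_empty.2 ?_)
    rintro rfl
    exact hA0 rfl
  · intro i hi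
    rcases Finset.mem_union.1 hi with hi | hi
    · exact (hS' i hi).ne
    · exact (hT' i hi).ne'
  · have hsum' : ∑ i ∈ S, (y i - x i) = ∑ i ∈ T, (x i - y i) := hsum
    have h1 : ∑ i ∈ S, y i = ∑ i ∈ S, (y i - x i) + ∑ i ∈ S, x i := by
      rw [← Finset.sum_add_distrib]
      exact Finset.sum_congr rfl fun i hi => (Nat.sub_add_cancel (hS' i hi).le).symm
    have h2 : ∑ i ∈ T, x i = ∑ i ∈ T, (x i - y i) + ∑ i ∈ T, y i := by
      rw [← Finset.sum_add_distrib]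
      exact Finset.sum_congr rfl fun i hi => (Nat.sub_add_cancel (hT' i hi).le).symm
    rw [Finset.sum_union hdisj, Finset.sum_union hdisj]
    omega

theorem Finset.sum_apply_piecewise {ι M : Type*} [Fintype ι] [DecidableEq ι]
    [AddCommMonoid M] {α : Type*} (U : Finset ι) (g : ι → α → M) (x y : ι → α) :
    ∑ i, g i (U.piecewise x y i) = ∑ i ∈ U, g i (x i) + ∑ i ∈ Uᶜ, g i (y i) := by
  rw [← Finset.sum_add_sum_compl U]
  refine congrArg₂ _ (Finset.sum_congr rfl fun i hi => ?_) (Finset.sum_congr rfl fun i hi => ?_)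
  · rw [Finset.piecewise_eq_of_mem _ _ _ hi]
  · rw [Finset.piecewise_eq_of_notMem _ _ _ (Finset.mem_compl.1 hi)]

theorem IsProfile.piecewise {n m k : ℕ} {x y : Fin n → ℕ} (hx : ∀ j, x j ≤ m)
    (hy : IsProfile n m k y) {U : Finset (Fin n)} (hU : ∑ i ∈ U, x i = ∑ i ∈ U, y i) :
    IsProfile n m k (U.piecewise x y) := by
  refine ⟨fun j => ?_, ?_⟩
  · by_cases hj : j ∈ U
    · simpa [hj] using hx j
    · simpa [hj] using hy.1 j
  · rw [Finset.sum_apply_piecewise U (fun _ a => a), hU, Finset.sum_add_sum_compl, hy.2]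

theorem revenue_piecewise_add_revenue_piecewise {n : ℕ} (R : Fin n → ℕ → ℝ) (x y : Fin n → ℕ)
    (U : Finset (Fin n)) :
    revenue R (U.piecewise x y) + revenue R (U.piecewise y x) = revenue R x + revenue R y := by
  simp only [revenue, Finset.sum_apply_piecewise]
  rw [← Finset.sum_add_sum_compl U fun i => R i (x i),
    ← Finset.sum_add_sum_compl U fun i => R i (y i)]
  ring

/-- Exchanging two optimal profiles on a set of coordinates with equal sums preserves
optimality. -/
theorem IsOptimalProfile.piecewise {n m k l : ℕ} {R : Fin n → ℕ → ℝ} {x y : Fin n → ℕ}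
    (hx : IsOptimalProfile n m k R x) (hy : IsOptimalProfile n m l R y) {U : Finset (Fin n)}
    (hU : ∑ i ∈ U, x i = ∑ i ∈ U, y i) : IsOptimalProfile n m l R (U.piecewise x y) := by
  refine ⟨IsProfile.piecewise hx.1.1 hy.1 hU, fun z hz => (hy.2 z hz).trans ?_⟩
  have h := hx.2 _ (IsProfile.piecewise hy.1.1 hx.1 hU.symm)
  linarith [revenue_piecewise_add_revenue_piecewise R x y U]

theorem finite_setOf_isProfile (n m k : ℕ) : {x | IsProfile n m k x}.Finite :=
  (Set.finite_Iic fun _ : Fin n => m).subset fun _ hx => hx.1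

theorem IsProfile.exists_succ {n m k : ℕ} {x : Fin n → ℕ} (hx : IsProfile n m k x)
    (hk : k < n * m) : ∃ y, IsProfile n m (k + 1) y := by
  obtain ⟨j, hj⟩ : ∃ j, x j < m := by
    by_contra! h
    have := Finset.sum_le_sum fun i (_ : i ∈ Finset.univ) => h i
    rw [hx.2] at this
    simp at this
    omega
  refine ⟨Function.update x j (x j + 1), fun i => ?_, ?_⟩
  · rcases eq_or_ne i j with rfl | hi
    · simpa using hj
    · simpa [hi] using hx.1 i
  · rw [Finset.sum_update_of_mem (Finset.mem_univ j), ← hx.2,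
      ← Finset.add_sum_erase _ x (Finset.mem_univ j), Finset.sdiff_singleton_eq_erase]
    ring

theorem IsProfile.exists_isOptimalProfile {n m k : ℕ} (R : Fin n → ℕ → ℝ) {x : Fin n → ℕ}
    (hx : IsProfile n m k x) : ∃ y, IsOptimalProfile n m k R y :=
  let ⟨y, hy, hmax⟩ := Set.exists_max_image _ (revenue R) (finite_setOf_isProfile n m k) ⟨x, hx⟩
  ⟨y, hy, hmax⟩

theorem exists_optimal_succ_profile_irreducible_diff
    (n m k : ℕ) (R : Fin n → ℕ → ℝ) (hk : k < n * m)
    (x : Fin n → ℕ) (hx : IsOptimalProfile n m k R x) :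
    ∃ y : Fin n → ℕ, IsOptimalProfile n m (k + 1) R y ∧
      ¬ Reducible (diffA x y) (diffB x y) := by
  obtain ⟨z, hz⟩ := hx.1.exists_succ hk
  obtain ⟨y, hy, hmin⟩ := Set.exists_min_image {y | IsOptimalProfile n m (k + 1) R y}
    (fun y => (Finset.univ.filter fun i => x i ≠ y i).card)
    ((finite_setOf_isProfile n m (k + 1)).subset fun _ hy => hy.1)
    (hz.exists_isOptimalProfile R)
  refine ⟨y, hy, fun hred => ?_⟩
  obtain ⟨U, ⟨a, ha⟩, hne, hU⟩ := hred.exists_sum_eq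
  refine (hmin _ (hx.piecewise hy hU)).not_gt (Finset.card_lt_card ?_)
  refine Finset.ssubset_iff_of_subset (fun i hi => ?_) |>.2 ⟨a, ?_, ?_⟩
  · by_cases hiU : i ∈ U
    · simp [hiU] at hi
    · simpa [hiU] using hi
  · simpa using hne a ha
  · simp [ha]
end

section
/- Let x be an optimal k-profile and y an optimal (k+1)-profile. If S ⊆ {1,...,n} is a set of indices such that Σ_{i∈S} y_i = Σ_{i∈S} x_i, then Σ_{i∈S} R_i(y_i) = Σ_{i∈S} R_i(x_i). -/
/-- An optimal profile is also optimal on every set of projects, among the allocations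
spending the same total number of efforts there. -/
theorem IsOptimalProfile.sum_revenue_le {n m k : ℕ} {R : Fin n → ℕ → ℝ} {x z : Fin n → ℕ}
    (hx : IsOptimalProfile n m k R x) (hz : ∀ j, z j ≤ m)
    {S : Finset (Fin n)} (hS : ∑ i ∈ S, z i = ∑ i ∈ S, x i) :
    ∑ i ∈ S, R i (z i) ≤ ∑ i ∈ S, R i (x i) := by
  obtain ⟨⟨hxm, hxk⟩, hopt⟩ := hx
  have split {M : Type} [AddCommMonoid M] (f : Fin n → ℕ → M) :
      ∑ j, f j (S.piecewise z x j) = ∑ i ∈ S, f i (z i) + ∑ i ∈ Sᶜ, f i (x i) := by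
    rw [← Finset.sum_add_sum_compl S]
    congr 1
    · exact Finset.sum_congr rfl fun i hi => by rw [Finset.piecewise_eq_of_mem _ _ _ hi]
    · exact Finset.sum_congr rfl fun i hi => by
        rw [Finset.piecewise_eq_of_notMem _ _ _ (Finset.mem_compl.mp hi)]
  have hprofile : IsProfile n m k (S.piecewise z x) := by
    refine ⟨fun j => ?_, ?_⟩
    · by_cases hj : j ∈ S
      · simpa [hj] using hz j
      · simpa [hj] using hxm j
    · rw [split fun _ a => a, hS, Finset.sum_add_sum_compl, hxk]
  have h := hopt _ hprofile
  rw [revenue, revenue, split R, ← Finset.sum_add_sum_compl S fun j => R j (x j)] at h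
  exact le_of_add_le_add_right h

theorem sum_revenue_eq_of_sum_eq
    (n m k : ℕ) (R : Fin n → ℕ → ℝ)
    (x y : Fin n → ℕ)
    (hx : IsOptimalProfile n m k R x)
    (hy : IsOptimalProfile n m (k + 1) R y)
    (S : Finset (Fin n)) (hS : ∑ i ∈ S, y i = ∑ i ∈ S, x i) :
    ∑ i ∈ S, R i (y i) = ∑ i ∈ S, R i (x i) :=
  le_antisymm (hx.sum_revenue_le hy.1.1 hS) (hy.sum_revenue_le hx.1.1 hS.symm)
end

section
/- The irreducible pairs (A,B) of finite multisets with elements in {1,2,3} satisfying (sum of A) − (sum of B) = 1 are exactly the five pairs: A = {1}, B = ∅; A = {2}, B = {1}; A = {3}, B = {2}; A = {3}, B = {1,1}; and A = {2,2}, B = {3}. -/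
/-- The multiset with `a` ones, `b` twos and `c` threes. -/
def onesTwosThrees (a b c : ℕ) : Multiset ℕ :=
  Multiset.replicate a 1 + Multiset.replicate b 2 + Multiset.replicate c 3

theorem sum_onesTwosThrees (a b c : ℕ) : (onesTwosThrees a b c).sum = a + 2 * b + 3 * c := by
  simp [onesTwosThrees, mul_comm]

theorem onesTwosThrees_mono {a b c a' b' c' : ℕ} (ha : a ≤ a') (hb : b ≤ b') (hc : c ≤ c') :
    onesTwosThrees a b c ≤ onesTwosThrees a' b' c' :=
  add_le_add (add_le_add (Multiset.replicate_mono 1 ha) (Multiset.replicate_mono 2 hb))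
    (Multiset.replicate_mono 3 hc)

theorem exists_eq_onesTwosThrees (A : Multiset ℕ) (hA : ∀ a ∈ A, 1 ≤ a ∧ a ≤ 3) :
    ∃ a b c, A = onesTwosThrees a b c := by
  refine ⟨A.count 1, A.count 2, A.count 3, ?_⟩
  ext n
  by_cases hn : n ∈ A
  · obtain ⟨h1, h3⟩ := hA n hn
    interval_cases n <;> simp [onesTwosThrees, Multiset.count_replicate]
  · have h0 := Multiset.count_eq_zero_of_notMem hn
    simp only [onesTwosThrees, Multiset.count_add, Multiset.count_replicate]
    split_ifs <;> simp_all

theorem reducible_onesTwosThrees {a b c a' b' c' : ℕ} (x y z x' y' z' : ℕ)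
    (hle : x ≤ a ∧ y ≤ b ∧ z ≤ c ∧ x' ≤ a' ∧ y' ≤ b' ∧ z' ≤ c')
    (hpos : 0 < x + 2 * y + 3 * z) (hsum : x + 2 * y + 3 * z = x' + 2 * y' + 3 * z') :
    Reducible (onesTwosThrees a b c) (onesTwosThrees a' b' c') := by
  obtain ⟨hx, hy, hz, hx', hy', hz'⟩ := hle
  refine ⟨_, _, onesTwosThrees_mono hx hy hz, onesTwosThrees_mono hx' hy' hz', ?_, ?_, ?_⟩
  · intro h
    have := congrArg Multiset.sum h
    rw [sum_onesTwosThrees, Multiset.sum_zero] at this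
    omega
  · intro h
    have := congrArg Multiset.sum h
    rw [sum_onesTwosThrees, Multiset.sum_zero] at this
    omega
  · rwa [sum_onesTwosThrees, sum_onesTwosThrees]

theorem not_reducible_iff_powerset (A B : Multiset ℕ) :
    ¬ Reducible A B ↔
      ∀ A₀ ∈ A.powerset, ∀ B₀ ∈ B.powerset, A₀ ≠ 0 → B₀ ≠ 0 → A₀.sum ≠ B₀.sum := by
  simp only [Reducible, Multiset.mem_powerset]
  grind

theorem irreducible_pairs_m_three (A B : Multiset ℕ) :
    ((∀ a ∈ A, 1 ≤ a ∧ a ≤ 3) ∧ (∀ b ∈ B, 1 ≤ b ∧ b ≤ 3) ∧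
      A.sum = B.sum + 1 ∧ ¬ Reducible A B) ↔
    ((A = {1} ∧ B = 0) ∨ (A = {2} ∧ B = {1}) ∨ (A = {3} ∧ B = {2}) ∨
      (A = {3} ∧ B = ({1, 1} : Multiset ℕ)) ∨ (A = ({2, 2} : Multiset ℕ) ∧ B = {3})) := by
  constructor
  · rintro ⟨hA, hB, hsum, hred⟩
    obtain ⟨a, b, c, rfl⟩ := exists_eq_onesTwosThrees A hA
    obtain ⟨a', b', c', rfl⟩ := exists_eq_onesTwosThrees B hB
    rw [sum_onesTwosThrees, sum_onesTwosThrees] at hsum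
    have key (x y z x' y' z' : ℕ) (hpos : 0 < x + 2 * y + 3 * z)
        (hs : x + 2 * y + 3 * z = x' + 2 * y' + 3 * z') :
        ¬ (x ≤ a ∧ y ≤ b ∧ z ≤ c ∧ x' ≤ a' ∧ y' ≤ b' ∧ z' ≤ c') :=
      fun hle ↦ hred (reducible_onesTwosThrees x y z x' y' z' hle hpos hs)
    have hcases :
        (a = 1 ∧ b = 0 ∧ c = 0 ∧ a' = 0 ∧ b' = 0 ∧ c' = 0) ∨
        (a = 0 ∧ b = 1 ∧ c = 0 ∧ a' = 1 ∧ b' = 0 ∧ c' = 0) ∨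
        (a = 0 ∧ b = 0 ∧ c = 1 ∧ a' = 0 ∧ b' = 1 ∧ c' = 0) ∨
        (a = 0 ∧ b = 0 ∧ c = 1 ∧ a' = 2 ∧ b' = 0 ∧ c' = 0) ∨
        (a = 0 ∧ b = 2 ∧ c = 0 ∧ a' = 0 ∧ b' = 0 ∧ c' = 1) := by
      have ha : a = 0 ∨ a' = 0 := by have := key 1 0 0 1 0 0; omega
      have hb : b = 0 ∨ b' = 0 := by have := key 0 1 0 0 1 0; omega
      have hc : c = 0 ∨ c' = 0 := by have := key 0 0 1 0 0 1; omega
      have h11_2 := key 2 0 0 0 1 0 (by simp) rfl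
      have h2_11 := key 0 1 0 2 0 0 (by simp) rfl
      have h111_3 := key 3 0 0 0 0 1 (by simp) rfl
      have h3_111 := key 0 0 1 3 0 0 (by simp) rfl
      have h12_3 := key 1 1 0 0 0 1 (by simp) rfl
      have h3_12 := key 0 0 1 1 1 0 (by simp) rfl
      have h13_22 := key 1 0 1 0 2 0 (by simp) rfl
      have h22_13 := key 0 2 0 1 0 1 (by simp) rfl
      have h222_33 := key 0 3 0 0 0 2 (by simp) rfl
      have h33_222 := key 0 0 2 0 3 0 (by simp) rfl
      clear key hred hA hB
      rcases ha with rfl | rfl <;> rcases hb with rfl | rfl <;> rcases hc with rfl | rfl <;> grind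
    rcases hcases with h | h | h | h | h <;>
      obtain ⟨rfl, rfl, rfl, rfl, rfl, rfl⟩ := h <;> decide
  · rintro (⟨rfl, rfl⟩ | ⟨rfl, rfl⟩ | ⟨rfl, rfl⟩ | ⟨rfl, rfl⟩ | ⟨rfl, rfl⟩) <;>
      rw [not_reducible_iff_powerset] <;> decide
end

section
/- Suppose every revenue function R_j : {0,1,...,m} → ℝ is convex, R_j(0) = 0 for all j, and the projects are sorted so that R_1(m) ≥ R_2(m) ≥ ... ≥ R_n(m). If 0 ≤ k ≤ n·m and m divides k, then the maximum revenue of a k-profile equals Σ_{j=1}^{k/m} R_j(m). -/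
/-- A convex function vanishing at `0` lies below its chords from the origin. -/
theorem mul_le_mul_of_convex {m : ℕ} {f : ℕ → ℝ} (hf0 : f 0 = 0)
    (hf : ∀ t : ℕ, 1 ≤ t → t + 1 ≤ m → f t - f (t - 1) ≤ f (t + 1) - f t)
    {t : ℕ} (ht : t ≤ m) : (m : ℝ) * f t ≤ t * f m := by
  have step : ∀ s : ℕ, s + 1 ≤ m → f s ≤ s * (f (s + 1) - f s) := by
    intro s
    induction s with
    | zero => simp [hf0]
    | succ s ih =>
      intro hs
      have h₁ := ih (by omega)
      have h₂ := hf (s + 1) (by omega) hs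
      rw [Nat.add_sub_cancel] at h₂
      push_cast
      nlinarith [mul_le_mul_of_nonneg_left h₂ (by positivity : (0 : ℝ) ≤ s + 1)]
  have chord : ∀ s : ℕ, t ≤ s → s ≤ m → (s : ℝ) * f t ≤ t * f s := by
    intro s hts
    induction s, hts using Nat.le_induction with
    | base => intro _; exact le_rfl
    | succ s hts ih =>
      intro hs
      rcases Nat.eq_zero_or_pos s with rfl | hpos
      · obtain rfl : t = 0 := by omega
        simp [hf0]
      · have hpos' : (0 : ℝ) < s := by exact_mod_cast hpos
        have h₁ := mul_le_mul_of_nonneg_left (ih (by omega)) (by positivity : (0 : ℝ) ≤ s + 1)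
        have h₂ := mul_le_mul_of_nonneg_left (step s hs) (Nat.cast_nonneg (α := ℝ) t)
        push_cast
        refine le_of_mul_le_mul_left ?_ hpos'
        nlinarith
  exact chord m ht le_rfl

/-- A nonincreasing finite sequence has a threshold value separating its first `q` terms from
the remaining ones. -/
theorem exists_threshold {n : ℕ} {r : Fin n → ℝ} (hr : Antitone r) (q : ℕ) :
    ∃ c : ℝ, (∀ j : Fin n, (j : ℕ) < q → c ≤ r j) ∧ ∀ j : Fin n, q ≤ (j : ℕ) → r j ≤ c := by
  by_cases hq : q < n
  · exact ⟨r ⟨q, hq⟩, fun j hj => hr (Fin.le_def.2 hj.le), fun j hj => hr (Fin.le_def.2 hj)⟩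
  · obtain ⟨c, hc⟩ := (Set.finite_range r).bddBelow
    exact ⟨c, fun j _ => hc ⟨j, rfl⟩, fun j hj => absurd j.isLt (by omega)⟩

theorem sum_ite_val_lt {n q : ℕ} (hq : q ≤ n) (m : ℕ) :
    ∑ j : Fin n, (if (j : ℕ) < q then m else 0) = q * m := by
  rw [← Finset.sum_filter, Finset.sum_const, Fin.card_filter_val_lt, min_eq_right hq, smul_eq_mul]

/-- Among weights in `[0, m]` of total `q * m`, putting weight `m` on the `q` largest terms
maximizes the weighted sum. -/
theorem sum_mul_le_mul_sum_filter {n m q : ℕ} (hq : q ≤ n) {r : Fin n → ℝ} (hr : Antitone r)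
    {x : Fin n → ℕ} (hx : IsProfile n m (q * m) x) :
    ∑ j, (x j : ℝ) * r j ≤ m * ∑ j ∈ Finset.univ.filter (fun j : Fin n => (j : ℕ) < q), r j := by
  obtain ⟨c, hc₁, hc₂⟩ := exists_threshold hr q
  have hsum : ∑ j, (x j : ℝ) = ∑ j : Fin n, (if (j : ℕ) < q then (m : ℝ) else 0) := by
    exact_mod_cast hx.2.trans (sum_ite_val_lt hq m).symm
  have hle : ∑ j, (x j : ℝ) * (r j - c)
      ≤ ∑ j : Fin n, (if (j : ℕ) < q then (m : ℝ) else 0) * (r j - c) := by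
    refine Finset.sum_le_sum fun j _ => ?_
    split_ifs with hj
    · exact mul_le_mul_of_nonneg_right (by exact_mod_cast hx.1 j) (sub_nonneg.2 (hc₁ j hj))
    · rw [zero_mul]
      exact mul_nonpos_of_nonneg_of_nonpos (Nat.cast_nonneg _)
        (sub_nonpos.2 (hc₂ j (not_lt.1 hj)))
  simp only [mul_sub, Finset.sum_sub_distrib, ← Finset.sum_mul, hsum] at hle
  rw [Finset.mul_sum, Finset.sum_filter]
  simpa only [ite_mul, zero_mul] using (sub_le_sub_iff_right _).1 hle

theorem max_revenue_of_dvd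
    (n m : ℕ) (R : Fin n → ℕ → ℝ)
    (hR0 : ∀ j, R j 0 = 0)
    (hconv : ∀ (j : Fin n) (t : ℕ), 1 ≤ t → t + 1 ≤ m →
      R j t - R j (t - 1) ≤ R j (t + 1) - R j t)
    (hsort : ∀ i j : Fin n, i ≤ j → R j m ≤ R i m)
    (k : ℕ) (hk : k ≤ n * m) (hdvd : m ∣ k) :
    IsGreatest {r : ℝ | ∃ x : Fin n → ℕ, IsProfile n m k x ∧ r = revenue R x}
      (∑ j ∈ Finset.univ.filter (fun j : Fin n => (j : ℕ) < k / m), R j m) := by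
  obtain ⟨q, rfl⟩ := hdvd
  rcases Nat.eq_zero_or_pos m with rfl | hm
  · refine ⟨⟨0, ⟨fun _ => le_rfl, by simp⟩, by simp [revenue, hR0]⟩, ?_⟩
    rintro _ ⟨x, hx, rfl⟩
    have hx0 : ∀ j, x j = 0 := fun j => Nat.le_zero.1 (hx.1 j)
    simp [revenue, hx0, hR0]
  rw [Nat.mul_div_cancel_left q hm, mul_comm m q]
  have hq : q ≤ n := Nat.le_of_mul_le_mul_right (by rwa [mul_comm m q] at hk) hm
  constructor
  · refine ⟨fun j => if (j : ℕ) < q then m else 0, ⟨fun j => ?_, sum_ite_val_lt hq m⟩, ?_⟩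
    · dsimp only
      split_ifs <;> simp
    · rw [revenue, Finset.sum_filter]
      refine Finset.sum_congr rfl fun j _ => ?_
      split_ifs <;> simp [hR0]
  · rintro _ ⟨x, hx, rfl⟩
    have hm' : (0 : ℝ) < m := by exact_mod_cast hm
    refine le_of_mul_le_mul_left ?_ hm'
    calc (m : ℝ) * revenue R x = ∑ j, (m : ℝ) * R j (x j) := Finset.mul_sum _ _ _
      _ ≤ ∑ j, (x j : ℝ) * R j m :=
        Finset.sum_le_sum fun j _ => mul_le_mul_of_convex (hR0 j) (hconv j) (hx.1 j)
      _ ≤ _ := sum_mul_le_mul_sum_filter hq (r := fun j => R j m) (fun i j h => hsort i j h) hx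
end

section
/- Suppose every revenue function R_j : {0,1,...,m} → ℝ is convex, R_j(0) = 0 for all j, and the projects are sorted so that R_1(m) ≥ R_2(m) ≥ ... ≥ R_n(m). Let 1 ≤ k ≤ n·m with c := k mod m ≠ 0 and q := ⌊k/m⌋. For i ≤ q+1 let x^(i) be the profile that allocates c efforts to project i, m efforts to each project j ∈ {1,...,q+1} \ {i}, and 0 to all other projects; for i > q+1 let x^(i) be the profile that allocates c efforts to project i, m efforts to each project j ∈ {1,...,q}, and 0 to all other projects. Then at least one of x^(1), ..., x^(n) is an optimal k-profile. -/
/-- The candidate profile `x⁽ⁱ⁾` (projects indexed `0, …, n-1`):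
project `i` gets `c = k % m` efforts; if `i ≤ q` (i.e. `i` is among the first
`q+1` projects) then every other project among the first `q+1` gets `m` efforts,
and if `i > q` then each of the first `q` projects gets `m` efforts;
all remaining projects get `0` efforts.  Here `q = k / m`. -/
def candidate (n m k : ℕ) (i : Fin n) : Fin n → ℕ := fun j =>
  if j = i then k % m
  else if (j : ℕ) < (if (i : ℕ) ≤ k / m then k / m + 1 else k / m) then m
  else 0

theorem Finset.sum_le_sum_of_card_eq_of_sdiff_le {ι : Type*} [DecidableEq ι] {S T : Finset ι}
    {f : ι → ℝ} (hcard : S.card = T.card) (h : ∀ l ∈ S \ T, ∀ j ∈ T \ S, f l ≤ f j) :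
    ∑ j ∈ S, f j ≤ ∑ j ∈ T, f j := by
  have hd : (S \ T).card = (T \ S).card := Finset.card_sdiff_comm hcard
  rw [← Finset.sum_inter_add_sum_sdiff S T f, ← Finset.sum_inter_add_sum_sdiff T S f,
    Finset.inter_comm T S]
  gcongr 1
  rcases (S \ T).eq_empty_or_nonempty with h0 | h0
  · have h1 : T \ S = ∅ := by
      rw [← Finset.card_eq_zero, ← hd, h0, Finset.card_empty]
    rw [h0, h1]
  · obtain ⟨l, hl, hmax⟩ := Finset.exists_max_image (S \ T) f h0
    calc ∑ j ∈ S \ T, f j ≤ (S \ T).card • f l := Finset.sum_le_card_nsmul _ _ _ hmax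
      _ = (T \ S).card • f l := by rw [hd]
      _ ≤ ∑ j ∈ T \ S, f j := Finset.card_nsmul_le_sum _ _ _ (h l hl)

theorem Finset.sum_eq_add_sum_of_ite {ι α M : Type*} [Fintype ι] [DecidableEq ι] [Zero α]
    [AddCommMonoid M] {F : ι → α → M} (hF : ∀ j, F j 0 = 0) {i : ι} {S : Finset ι} (hi : i ∉ S)
    {c m : α} {x : ι → α} (hx : ∀ j, x j = if j = i then c else if j ∈ S then m else 0) :
    ∑ j, F j (x j) = F i c + ∑ j ∈ S, F j m := by
  rw [← Finset.sum_subset (Finset.subset_univ (insert i S)), Finset.sum_insert hi]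
  · congr 1
    · simp [hx]
    · refine Finset.sum_congr rfl fun j hj => ?_
      have : j ≠ i := fun h => hi (h ▸ hj)
      simp [hx, hj, this]
  · intro j _ hj
    rw [Finset.mem_insert, not_or] at hj
    simp [hx, hj.1, hj.2, hF]

/-- Changing a function at two points changes a sum by the two differences. -/
theorem Finset.sum_update_update_add {ι α M : Type*} [Fintype ι] [DecidableEq ι]
    [AddCommMonoid M] (F : ι → α → M) (x : ι → α) {a b : ι} (hab : a ≠ b) (u v : α) :
    ∑ j, F j (Function.update (Function.update x a u) b v j) + (F a (x a) + F b (x b)) =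
      ∑ j, F j (x j) + (F a u + F b v) := by
  have hb : b ∈ Finset.univ.erase a := Finset.mem_erase.2 ⟨hab.symm, Finset.mem_univ b⟩
  rw [← Finset.add_sum_erase _ _ (Finset.mem_univ a), ← Finset.add_sum_erase _ _ hb,
    ← Finset.add_sum_erase _ (fun j => F j (x j)) (Finset.mem_univ a),
    ← Finset.add_sum_erase _ (fun j => F j (x j)) hb]
  have hrest : ∑ j ∈ (Finset.univ.erase a).erase b,
      F j (Function.update (Function.update x a u) b v j) =
      ∑ j ∈ (Finset.univ.erase a).erase b, F j (x j) := by
    refine Finset.sum_congr rfl fun j hj => ?_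
    simp only [Finset.mem_erase] at hj
    rw [Function.update_of_ne hj.1, Function.update_of_ne hj.2.1]
  rw [hrest, Function.update_of_ne hab, Function.update_self, Function.update_self]
  abel

theorem exists_isProfile {n m k : ℕ} (hk : k ≤ n * m) : ∃ x, IsProfile n m k x := by
  induction n generalizing k with
  | zero => exact ⟨fun _ => 0, fun _ => Nat.zero_le _, by simp at hk ⊢; omega⟩
  | succ n ih =>
    obtain ⟨x, hx, hs⟩ := ih (k := k - m) (by rw [Nat.succ_mul] at hk; omega)
    refine ⟨Fin.cons (min k m) x, fun j => ?_, ?_⟩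
    · refine Fin.cases ?_ (fun j => ?_) j
      · simp
      · simpa using hx j
    · rw [Fin.sum_univ_succ]
      simp only [Fin.cons_zero, Fin.cons_succ, hs]
      omega

/-- Some optimal profile maximizes the sum of squares among all optimal profiles. -/
theorem exists_isOptimalProfile_sum_sq_max {n m k : ℕ} (R : Fin n → ℕ → ℝ) (hk : k ≤ n * m) :
    ∃ x, IsOptimalProfile n m k R x ∧
      ∀ y, IsProfile n m k y → revenue R x ≤ revenue R y → ∑ j, y j ^ 2 ≤ ∑ j, x j ^ 2 := by
  obtain ⟨x, hx, hmax⟩ := Set.exists_max_image {x | IsProfile n m k x}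
    (fun x => toLex (revenue R x, ∑ j, x j ^ 2)) (finite_setOf_isProfile n m k)
    (exists_isProfile hk)
  refine ⟨x, ⟨hx, fun y hy => ?_⟩, fun y hy hxy => ?_⟩
  · rcases Prod.Lex.toLex_le_toLex.1 (hmax y hy) with h | h
    exacts [h.le, h.1.le]
  · rcases Prod.Lex.toLex_le_toLex.1 (hmax y hy) with h | h
    exacts [absurd h hxy.not_gt, h.2]

/-- Moving one unit of effort from project `b` to project `a`. -/
theorem IsProfile.exists_move {n m k : ℕ} {x : Fin n → ℕ} (hx : IsProfile n m k x)
    (R : Fin n → ℕ → ℝ) {a b : Fin n} (hab : a ≠ b) (ha : x a < m) (hb : 0 < x b) :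
    ∃ y, IsProfile n m k y ∧
      revenue R y + (R a (x a) + R b (x b)) =
        revenue R x + (R a (x a + 1) + R b (x b - 1)) ∧
      ∑ j, y j ^ 2 + (x a ^ 2 + x b ^ 2) = ∑ j, x j ^ 2 + ((x a + 1) ^ 2 + (x b - 1) ^ 2) := by
  refine ⟨Function.update (Function.update x a (x a + 1)) b (x b - 1), ⟨fun j => ?_, ?_⟩,
    Finset.sum_update_update_add R x hab _ _,
    Finset.sum_update_update_add (fun _ t => t ^ 2) x hab _ _⟩
  · have := hx.1 j
    have := hx.1 b
    simp only [Function.update_apply]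
    split_ifs <;> omega
  · have := Finset.sum_update_update_add (fun _ t => t) x hab (x a + 1) (x b - 1)
    have := hx.2
    omega

/-- With convex revenue functions, some optimal profile has at most one project whose allocation
is strictly between `0` and `m`. -/
theorem exists_isOptimalProfile_subsingleton_interior {n m k : ℕ} {R : Fin n → ℕ → ℝ}
    (hconv : ∀ (j : Fin n) (t : ℕ), 1 ≤ t → t + 1 ≤ m →
      R j t - R j (t - 1) ≤ R j (t + 1) - R j t) (hk : k ≤ n * m) :
    ∃ x, IsOptimalProfile n m k R x ∧ {j | 0 < x j ∧ x j < m}.Subsingleton := by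
  obtain ⟨x, hx, hsq⟩ := exists_isOptimalProfile_sum_sq_max R hk
  refine ⟨x, hx, fun a ha b hb => ?_⟩
  by_contra hab
  wlog hle : x b ≤ x a generalizing a b
  · exact this b hb a ha (Ne.symm hab) (by omega)
  obtain ⟨y, hy, hyr, hys⟩ := hx.1.exists_move R hab ha.2 hb.1
  obtain ⟨z, hz, hzr, -⟩ := hx.1.exists_move R (Ne.symm hab) hb.2 ha.1
  have hyx := hx.2 y hy
  have hzx := hx.2 z hz
  have hca := hconv a (x a) ha.1 ha.2
  have hcb := hconv b (x b) hb.1 hb.2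
  have hs := hsq y hy (by linarith)
  obtain ⟨t, ht⟩ : ∃ t, x b = t + 1 := ⟨x b - 1, by have := hb.1; omega⟩
  rw [ht, Nat.add_sub_cancel] at hys
  nlinarith

/-- The projects receiving full effort `m` in the `i`-th candidate profile. -/
def candidateFull (n m k : ℕ) (i : Fin n) : Finset (Fin n) :=
  (Finset.univ.filter fun j : Fin n =>
    (j : ℕ) < if (i : ℕ) ≤ k / m then k / m + 1 else k / m).erase i

theorem candidate_eq_ite (n m k : ℕ) (i j : Fin n) :
    candidate n m k i j =
      if j = i then k % m else if j ∈ candidateFull n m k i then m else 0 := by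
  by_cases h : j = i <;> simp [candidate, candidateFull, h]

theorem notMem_candidateFull (n m k : ℕ) (i : Fin n) : i ∉ candidateFull n m k i :=
  Finset.notMem_erase _ _

theorem card_candidateFull {n m k : ℕ} (h : k / m < n) (i : Fin n) :
    (candidateFull n m k i).card = k / m := by
  unfold candidateFull
  split_ifs with hi
  · rw [Finset.card_erase_of_mem (by simp; omega), Fin.card_filter_val_lt]
    omega
  · rw [Finset.erase_eq_of_notMem (by simp; omega), Fin.card_filter_val_lt]
    omega

theorem isProfile_candidate {n m k : ℕ} (hm : 0 < m) (h : k / m < n) (i : Fin n) :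
    IsProfile n m k (candidate n m k i) := by
  refine ⟨fun j => ?_, ?_⟩
  · have := Nat.mod_lt k hm
    rw [candidate_eq_ite]
    split_ifs <;> omega
  · rw [Finset.sum_eq_add_sum_of_ite (F := fun _ t => t) (fun _ => rfl)
      (notMem_candidateFull n m k i) (candidate_eq_ite n m k i), Finset.sum_const,
      card_candidateFull h, smul_eq_mul, mul_comm, Nat.mod_add_div]

theorem exists_candidate_optimal
    (n m : ℕ) (R : Fin n → ℕ → ℝ)
    (hR0 : ∀ j, R j 0 = 0)
    (hconv : ∀ (j : Fin n) (t : ℕ), 1 ≤ t → t + 1 ≤ m →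
      R j t - R j (t - 1) ≤ R j (t + 1) - R j t)
    (hsort : ∀ i j : Fin n, i ≤ j → R j m ≤ R i m)
    (k : ℕ) (hk1 : 1 ≤ k) (hk2 : k ≤ n * m) (hc : k % m ≠ 0) :
    ∃ i : Fin n, IsOptimalProfile n m k R (candidate n m k i) := by
  have hm : 0 < m := by
    rcases Nat.eq_zero_or_pos m with rfl | h
    · omega
    · exact h
  have hq : k / m < n := by
    refine lt_of_le_of_ne (Nat.div_le_of_le_mul (by rwa [mul_comm])) fun h => ?_
    have := Nat.mod_add_div k m
    rw [h, mul_comm m n] at this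
    omega
  obtain ⟨x, hx, hint⟩ := exists_isOptimalProfile_subsingleton_interior hconv hk2
  obtain ⟨i, hi⟩ : ∃ i, 0 < x i ∧ x i < m := by
    by_contra! hno
    refine hc (Nat.mod_eq_zero_of_dvd (hx.1.2 ▸ Finset.dvd_sum fun j _ => ?_))
    rcases Nat.eq_zero_or_pos (x j) with h | h
    · exact h ▸ dvd_zero m
    · exact (hno j h).antisymm (hx.1.1 j) ▸ dvd_rfl
  set S : Finset (Fin n) := Finset.univ.filter fun j => x j = m with hS
  have hiS : i ∉ S := by simp [hS, hi.2.ne]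
  have hxS : ∀ j, x j = if j = i then x i else if j ∈ S then m else 0 := by
    intro j
    by_cases hj : j = i
    · simp [hj]
    · have h1 := hx.1.1 j
      have h2 : ¬(0 < x j ∧ x j < m) := fun h => hj (hint h hi)
      simp only [hj, if_false, hS, Finset.mem_filter, Finset.mem_univ, true_and]
      split_ifs <;> omega
  have hsum : x i + m * S.card = k := by
    rw [← hx.1.2, Finset.sum_eq_add_sum_of_ite (F := fun _ t => t) (fun _ => rfl) hiS hxS,
      Finset.sum_const, smul_eq_mul, mul_comm]
  have hxi : x i = k % m := by
    rw [← hsum, Nat.add_mul_mod_self_left, Nat.mod_eq_of_lt hi.2]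
  have hcard : S.card = k / m := by
    rw [← hsum, Nat.add_mul_div_left _ _ hm, Nat.div_eq_of_lt hi.2, zero_add]
  refine ⟨i, isProfile_candidate hm hq i, fun y hy => (hx.2 y hy).trans ?_⟩
  rw [revenue, revenue, Finset.sum_eq_add_sum_of_ite hR0 hiS hxS,
    Finset.sum_eq_add_sum_of_ite hR0 (notMem_candidateFull n m k i) (candidate_eq_ite n m k i),
    hxi]
  gcongr 1
  refine Finset.sum_le_sum_of_card_eq_of_sdiff_le (hcard.trans (card_candidateFull hq i).symm)
    fun l hl j hj => hsort j l ?_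
  rw [Finset.mem_sdiff] at hl hj
  have hli : l ≠ i := fun h => hiS (h ▸ hl.1)
  have h1 := hl.2
  have h2 := hj.1
  simp only [candidateFull, Finset.mem_erase, Finset.mem_filter, Finset.mem_univ, true_and,
    not_and, not_lt] at h1 h2
  exact Fin.le_def.2 (h2.2.le.trans (h1 hli))
end

section
/- Let f : {0,1,...,N} → ℝ be concave and let g : {0,1,...,M} → ℝ be oscillating concave. Fix k with 0 ≤ k < N + M, and for each integer s with 0 ≤ s ≤ N+M define h(s) = max { f(i) + g(s−i) : max(0, s−M) ≤ i ≤ min(s, N) }. If i_k is a maximizer of f(i) + g(k−i) over max(0, k−M) ≤ i ≤ min(k, N), then f(i) + g(k+1−i) attains its maximum over max(0, k+1−M) ≤ i ≤ min(k+1, N) at some point i ∈ {i_k − 1, i_k, i_k + 1}. -/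
/-- The increments of a concave sequence on `{0, …, N}` are non-increasing. -/
theorem increment_le_of_concave {N : ℕ} {f : ℕ → ℝ}
    (hf : ∀ i : ℕ, 1 ≤ i → i + 1 ≤ N → f (i + 1) - f i ≤ f i - f (i - 1))
    {i j : ℕ} (hij : i ≤ j) (hj : j + 1 ≤ N) :
    f (j + 1) - f j ≤ f (i + 1) - f i := by
  induction j, hij using Nat.le_induction with
  | base => exact le_rfl
  | succ n _ ih =>
    have h := hf (n + 1) (by omega) hj
    rw [Nat.add_sub_cancel] at h
    exact h.trans (ih (by omega))


theorem maxplus_convolution_step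
    (N M : ℕ) (f g : ℕ → ℝ)
    -- `f` is concave on `{0, …, N}`
    (hf : ∀ i : ℕ, 1 ≤ i → i + 1 ≤ N → f (i + 1) - f i ≤ f i - f (i - 1))
    -- `g` is oscillating concave on `{0, …, M}`:
    -- (1) `g(2k)` is concave
    (hg1 : ∀ j : ℕ, 1 ≤ j → 2 * j + 2 ≤ M →
      g (2 * j + 2) - g (2 * j) ≤ g (2 * j) - g (2 * j - 2))
    -- (2) `g(2k+2) - g(2k+1) ≥ g(2k+1) - g(2k)`
    (hg2 : ∀ j : ℕ, 2 * j + 2 ≤ M →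
      g (2 * j + 1) - g (2 * j) ≤ g (2 * j + 2) - g (2 * j + 1))
    -- (3) `g(2k+1) - g(2k) ≤ g(2k) - g(2k-1)`
    (hg3 : ∀ j : ℕ, 1 ≤ j → 2 * j + 1 ≤ M →
      g (2 * j + 1) - g (2 * j) ≤ g (2 * j) - g (2 * j - 1))
    -- (4) `g(2k+1) - g(2k)` is non-increasing in `k`
    (hg4 : ∀ j₁ j₂ : ℕ, j₁ ≤ j₂ → 2 * j₂ + 1 ≤ M →
      g (2 * j₂ + 1) - g (2 * j₂) ≤ g (2 * j₁ + 1) - g (2 * j₁))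
    -- (5) `g(2k) - g(2k-1)` is non-increasing in `k`
    (hg5 : ∀ j₁ j₂ : ℕ, 1 ≤ j₁ → j₁ ≤ j₂ → 2 * j₂ ≤ M →
      g (2 * j₂) - g (2 * j₂ - 1) ≤ g (2 * j₁) - g (2 * j₁ - 1))
    (k : ℕ) (hk : k < N + M)
    (ik : ℕ) (hik_lb : k - M ≤ ik) (hik_ub : ik ≤ min k N)
    (hik_max : ∀ i : ℕ, k - M ≤ i → i ≤ min k N →
      f i + g (k - i) ≤ f ik + g (k - ik)) :
    ∃ i : ℕ, (i = ik - 1 ∨ i = ik ∨ i = ik + 1) ∧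
      (k + 1 - M ≤ i ∧ i ≤ min (k + 1) N) ∧
      ∀ j : ℕ, k + 1 - M ≤ j → j ≤ min (k + 1) N →
        f j + g (k + 1 - j) ≤ f i + g (k + 1 - i) := by
  obtain ⟨j, hj, hj_max⟩ := (Finset.Icc (k + 1 - M) (min (k + 1) N)).exists_max_image
    (fun i => f i + g (k + 1 - i)) ⟨k + 1 - M, Finset.mem_Icc.2 ⟨le_rfl, by omega⟩⟩
  rw [Finset.mem_Icc] at hj
  suffices h : ∃ i : ℕ, (i = ik - 1 ∨ i = ik ∨ i = ik + 1) ∧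
      (k + 1 - M ≤ i ∧ i ≤ min (k + 1) N) ∧ f j + g (k + 1 - j) ≤ f i + g (k + 1 - i) by
    obtain ⟨i, hi, hi_mem, hji⟩ := h
    exact ⟨i, hi, hi_mem, fun l hl hl' => (hj_max l (Finset.mem_Icc.2 ⟨hl, hl'⟩)).trans hji⟩
  obtain ⟨b, rfl⟩ := Nat.exists_eq_add_of_le (hik_ub.trans (min_le_left _ _))
  rcases lt_or_ge ik j with hlt | hge
  · -- to the right of `ik`, concavity of `f` alone makes `ik + 1` at least as good
    obtain ⟨t, rfl⟩ := Nat.exists_eq_add_of_lt hlt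
    refine ⟨ik + 1, by simp, by omega, ?_⟩
    have hstep := increment_le_of_concave hf (Nat.le_add_right ik t) (by omega)
    have hmax := hik_max (ik + t) (by omega) (by omega)
    rw [show ik + b - (ik + t) = b - t by omega, Nat.add_sub_cancel_left] at hmax
    rw [show ik + b + 1 - (ik + t + 1) = b - t by omega,
      show ik + b + 1 - (ik + 1) = b by omega]
    linarith
  obtain ⟨t, rfl⟩ := Nat.exists_eq_add_of_le hge
  rw [show j + t + b + 1 - j = b + t + 1 by omega]
  have hmax := hik_max j (by omega) (by omega)
  rw [show j + t + b - j = b + t by omega, Nat.add_sub_cancel_left] at hmax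
  -- `j + t` is at least as good as `j` when the last increment of `g` is at most the first
  have of_step (h : g (b + t + 1) - g (b + t) ≤ g (b + 1) - g b) :
      ∃ i : ℕ, (i = j + t - 1 ∨ i = j + t ∨ i = j + t + 1) ∧
        (j + t + b + 1 - M ≤ i ∧ i ≤ min (j + t + b + 1) N) ∧
        f j + g (b + t + 1) ≤ f i + g (j + t + b + 1 - i) := by
    refine ⟨j + t, by simp, by omega, ?_⟩
    rw [show j + t + b + 1 - (j + t) = b + 1 by omega]
    linarith
  rcases Nat.even_or_odd' b with ⟨m, rfl | rfl⟩ <;>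
    rcases Nat.even_or_odd' t with ⟨s, rfl | rfl⟩
  · apply of_step
    have h := hg4 m (m + s) (by omega) (by omega)
    rwa [mul_add] at h
  · refine ⟨j + 2 * s, by omega, by omega, ?_⟩
    have hmax' := hik_max (j + 1) (by omega) (by omega)
    have hstep := increment_le_of_concave hf (Nat.le_add_right j (2 * s)) (by omega)
    have ho := hg4 m (m + s) (by omega) (by omega)
    have he := hg5 (m + 1) (m + s + 1) (by omega) (by omega) (by omega)
    rw [show j + (2 * s + 1) + 2 * m - (j + 1) = 2 * m + 2 * s by omega,
      Nat.add_sub_cancel_left, ← add_assoc] at hmax'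
    rw [show 2 * (m + s) = 2 * m + 2 * s by ring] at ho
    rw [show 2 * (m + s + 1) - 1 = 2 * m + 2 * s + 1 by omega,
      show 2 * (m + s + 1) = 2 * m + 2 * s + 2 by ring,
      show 2 * (m + 1) - 1 = 2 * m + 1 by omega, show 2 * (m + 1) = 2 * m + 2 by ring] at he
    rw [show 2 * m + (2 * s + 1) + 1 = 2 * m + 2 * s + 2 by ring,
      show j + (2 * s + 1) + 2 * m + 1 - (j + 2 * s) = 2 * m + 2 by omega]
    linarith
  · apply of_step
    have h := hg5 (m + 1) (m + s + 1) (by omega) (by omega) (by omega)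
    rw [show 2 * (m + s + 1) - 1 = 2 * m + 1 + 2 * s by omega,
      show 2 * (m + s + 1) = 2 * m + 1 + 2 * s + 1 by ring,
      show 2 * (m + 1) - 1 = 2 * m + 1 by omega] at h
    exact h
  · apply of_step
    have h := hg5 (m + 1) (m + s + 1) (by omega) (by omega) (by omega)
    have ho := hg3 (m + s + 1) (by omega) (by omega)
    rw [show 2 * m + 1 + (2 * s + 1) = 2 * (m + s + 1) by ring]
    exact ho.trans h
end

section
/- Let a_1, ..., a_n and b_1, ..., b_n be real numbers with a_i > b_i for every i. For 0 ≤ k ≤ 2n let f(k) be the maximum of Σ_{i : x_i ≥ 1} a_i + Σ_{i : x_i = 2} b_i over all vectors x ∈ {0,1,2}^n with Σ_i x_i = k. Then f is concave, i.e., f(k+1) − f(k) ≤ f(k) − f(k−1) for all 1 ≤ k ≤ 2n−1. -/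
/-- Total revenue of an allocation `x` (with `x i ∈ {0,1,2}`) to projects `1, …, n`:
project `i` yields `0`, `a i`, or `a i + b i` when allocated `0`, `1`, or `2` efforts. -/
def rev (n : ℕ) (a b : ℕ → ℝ) (x : ℕ → ℕ) : ℝ :=
  ∑ i ∈ Finset.Icc 1 n, ((if 1 ≤ x i then a i else 0) + (if x i = 2 then b i else 0))

/-- Changing one coordinate of `x` changes a separable sum only in the corresponding term. -/
theorem sum_update_add {ι α M : Type*} [DecidableEq ι] [AddCommMonoid M] (s : Finset ι)
    (F : ι → α → M) (x : ι → α) {i : ι} (hi : i ∈ s) (c : α) :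
    ∑ j ∈ s, F j (Function.update x i c j) + F i (x i) = ∑ j ∈ s, F j (x j) + F i c := by
  have h : ∑ j ∈ s.erase i, F j (Function.update x i c j) = ∑ j ∈ s.erase i, F j (x j) :=
    Finset.sum_congr rfl fun j hj => by
      rw [Function.update_of_ne (Finset.ne_of_mem_erase hj)]
  rw [← Finset.add_sum_erase s _ hi, ← Finset.add_sum_erase s (fun j => F j (x j)) hi, h,
    Function.update_self]
  ac_rfl

theorem max_revenue_concave
    (n : ℕ) (a b : ℕ → ℝ) (f : ℕ → ℝ)
    (hab : ∀ i ∈ Finset.Icc 1 n, b i < a i)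
    (hf : ∀ k ≤ 2 * n,
      IsGreatest
        {r : ℝ | ∃ x : ℕ → ℕ, (∀ i ∈ Finset.Icc 1 n, x i ≤ 2) ∧
          (∑ i ∈ Finset.Icc 1 n, x i = k) ∧ r = rev n a b x}
        (f k)) :
    ∀ k : ℕ, 1 ≤ k → k + 1 ≤ 2 * n → f (k + 1) - f k ≤ f k - f (k - 1) := by
  intro k hk hk2
  obtain ⟨x, hx, hxs, hxr⟩ := (hf (k + 1) hk2).1
  obtain ⟨y, hy, hys, hyr⟩ := (hf (k - 1) (by omega)).1
  obtain ⟨i, hi, hlt⟩ : ∃ i ∈ Finset.Icc 1 n, y i < x i :=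
    Finset.exists_lt_of_sum_lt (by omega)
  have hxi := hx i hi
  have hu : rev n a b (Function.update x i (x i - 1)) ≤ f k := by
    refine (hf k (by omega)).2 ⟨_, fun j hj => ?_, ?_, rfl⟩
    · have := hx j hj
      rw [Function.update_apply]
      split_ifs <;> omega
    · have := sum_update_add (Finset.Icc 1 n) (fun _ m => m) x hi (x i - 1)
      omega
  have hv : rev n a b (Function.update y i (y i + 1)) ≤ f k := by
    refine (hf k (by omega)).2 ⟨_, fun j hj => ?_, ?_, rfl⟩
    · have := hy j hj
      rw [Function.update_apply]
      split_ifs <;> omega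
    · have := sum_update_add (Finset.Icc 1 n) (fun _ m => m) y hi (y i + 1)
      omega
  let F : ℕ → ℕ → ℝ := fun j m => (if 1 ≤ m then a j else 0) + (if m = 2 then b j else 0)
  have hU : rev n a b (Function.update x i (x i - 1)) + F i (x i) = rev n a b x + F i (x i - 1) :=
    sum_update_add _ F x hi _
  have hV : rev n a b (Function.update y i (y i + 1)) + F i (y i) = rev n a b y + F i (y i + 1) :=
    sum_update_add _ F y hi _
  have key : F i (x i) + F i (y i) ≤ F i (x i - 1) + F i (y i + 1) := by
    have hb := hab i hi
    generalize x i = p at *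
    generalize y i = q at *
    have hq : q < 2 := by omega
    interval_cases q <;> interval_cases p <;> simp [F] <;> linarith
  linarith
end

section
/- Let a_1, ..., a_n and b_1, ..., b_n be real numbers with a_i ≤ b_i for every i, and suppose the projects are sorted so that a_1 + b_1 ≥ a_2 + b_2 ≥ ... ≥ a_n + b_n. For 0 ≤ k ≤ 2n let g(k) be the maximum of Σ_{i : x_i ≥ 1} a_i + Σ_{i : x_i = 2} b_i over all vectors x ∈ {0,1,2}^n with Σ_i x_i = k. Then for every even k = 2t with 0 ≤ t ≤ n, g(2t) = Σ_{i=1}^{t} (a_i + b_i). -/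
theorem sum_Icc_ite_le {M : Type*} [AddCommMonoid M] {n t : ℕ} (ht : t ≤ n) (f : ℕ → M) :
    ∑ i ∈ Finset.Icc 1 n, (if i ≤ t then f i else 0) = ∑ i ∈ Finset.Icc 1 t, f i := by
  rw [← Finset.sum_filter]
  congr 1
  ext i
  simp only [Finset.mem_filter, Finset.mem_Icc]
  omega

theorem rev_two_on_prefix {n t : ℕ} (ht : t ≤ n) (a b : ℕ → ℝ) :
    rev n a b (fun i => if i ≤ t then 2 else 0) = ∑ i ∈ Finset.Icc 1 t, (a i + b i) := by
  rw [← sum_Icc_ite_le ht, rev]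
  refine Finset.sum_congr rfl fun i _ => ?_
  by_cases h : i ≤ t <;> simp [h]

/-- Exchange argument: the value `a j + b j` at the cut `j = max t 1` serves as the price of
two efforts. -/
theorem rev_le_sum_prefix {n t : ℕ} (ht : t ≤ n) {a b : ℕ → ℝ} {x : ℕ → ℕ}
    (hab : ∀ i ∈ Finset.Icc 1 n, a i ≤ b i)
    (hsort : ∀ i j : ℕ, 1 ≤ i → i ≤ j → j ≤ n → a j + b j ≤ a i + b i)
    (hx : ∀ i ∈ Finset.Icc 1 n, x i ≤ 2) (hsum : ∑ i ∈ Finset.Icc 1 n, x i = 2 * t) :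
    rev n a b x ≤ ∑ i ∈ Finset.Icc 1 t, (a i + b i) := by
  obtain ⟨c, hc⟩ : ∃ c : ℝ, c = a (max t 1) + b (max t 1) := ⟨_, rfl⟩
  have hterm : ∀ i ∈ Finset.Icc 1 n,
      (if 1 ≤ x i then a i else 0) + (if x i = 2 then b i else 0) ≤
        (x i : ℝ) * (c / 2) + (if i ≤ t then a i + b i - c else 0) := by
    intro i hi
    have hai := hab i hi
    have hxi := hx i hi
    rw [Finset.mem_Icc] at hi
    by_cases hit : i ≤ t
    · have hci : c ≤ a i + b i := by
        rw [hc]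
        exact hsort i _ hi.1 (by omega) (by omega)
      interval_cases x i <;> simp [hit] <;> linarith
    · have hci : a i + b i ≤ c := by
        rw [hc]
        exact hsort _ i (by omega) (by omega) hi.2
      interval_cases x i <;> simp [hit] <;> linarith
  have hsum' : ∑ i ∈ Finset.Icc 1 n, (x i : ℝ) = 2 * t := by exact_mod_cast hsum
  calc rev n a b x
      ≤ ∑ i ∈ Finset.Icc 1 n,
          ((x i : ℝ) * (c / 2) + (if i ≤ t then a i + b i - c else 0)) :=
        Finset.sum_le_sum hterm
    _ = ∑ i ∈ Finset.Icc 1 t, (a i + b i) := by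
        rw [Finset.sum_add_distrib, ← Finset.sum_mul, hsum', sum_Icc_ite_le ht,
          Finset.sum_sub_distrib]
        simp only [Finset.sum_const, Nat.card_Icc, Nat.add_sub_cancel, nsmul_eq_mul]
        ring

theorem max_revenue_even
    (n : ℕ) (a b : ℕ → ℝ) (g : ℕ → ℝ)
    (hab : ∀ i ∈ Finset.Icc 1 n, a i ≤ b i)
    (hsort : ∀ i j : ℕ, 1 ≤ i → i ≤ j → j ≤ n → a j + b j ≤ a i + b i)
    (hg : ∀ k ≤ 2 * n,
      IsGreatest
        {r : ℝ | ∃ x : ℕ → ℕ, (∀ i ∈ Finset.Icc 1 n, x i ≤ 2) ∧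
          (∑ i ∈ Finset.Icc 1 n, x i = k) ∧ r = rev n a b x}
        (g k)) :
    ∀ t : ℕ, t ≤ n → g (2 * t) = ∑ i ∈ Finset.Icc 1 t, (a i + b i) := by
  intro t ht
  refine (hg (2 * t) (by omega)).unique ⟨⟨fun i => if i ≤ t then 2 else 0, ?_, ?_, ?_⟩, ?_⟩
  · intro i _
    dsimp only
    split_ifs <;> omega
  · rw [sum_Icc_ite_le ht (fun _ => 2)]
    simp [mul_comm]
  · exact (rev_two_on_prefix ht a b).symm
  · rintro r ⟨x, hx, hsum, rfl⟩
    exact rev_le_sum_prefix ht hab hsort hx hsum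
end

section
/- Let a_1, ..., a_n and b_1, ..., b_n be real numbers with a_i ≤ b_i for every i. For every odd k with 1 ≤ k ≤ 2n−1, there exists a vector x ∈ {0,1,2}^n with Σ_i x_i = k that maximizes Σ_{i : x_i ≥ 1} a_i + Σ_{i : x_i = 2} b_i and in which exactly one index i satisfies x_i = 1. -/
/-- Revenue of the allocation `x` restricted to the projects in `s`. -/
def revenueOn {ι : Type*} (s : Finset ι) (a b : ι → ℝ) (x : ι → ℕ) : ℝ :=
  ∑ i ∈ s, ((if 1 ≤ x i then a i else 0) + (if x i = 2 then b i else 0))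

/-- `x` allocates at most two efforts to each project in `s`, and `k` efforts in total. -/
def IsAllocation {ι : Type*} (s : Finset ι) (k : ℕ) (x : ι → ℕ) : Prop :=
  (∀ i ∈ s, x i ≤ 2) ∧ ∑ i ∈ s, x i = k

lemma sum_update_pair {ι M : Type*} [DecidableEq ι] [AddCommMonoid M] (s : Finset ι)
    (g : ι → ℕ → M) (x : ι → ℕ) {i j : ι} (hi : i ∈ s) (hj : j ∈ s) (hij : i ≠ j) (u v : ℕ) :
    ∑ l ∈ s, g l (Function.update (Function.update x i u) j v l) =
      g i u + (g j v + ∑ l ∈ (s.erase i).erase j, g l (x l)) := by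
  rw [← Finset.add_sum_erase s _ hi,
    ← Finset.add_sum_erase (s.erase i) _ (Finset.mem_erase.2 ⟨hij.symm, hj⟩)]
  congr 1
  · simp [hij]
  · congr 1
    · simp
    · refine Finset.sum_congr rfl fun l hl => ?_
      simp only [Finset.mem_erase] at hl
      simp [hl.1, hl.2.1]

/-- Moving one effort from `j` to `i`, both of which have exactly one, does not decrease the
revenue if `a j ≤ b i`. -/
lemma exists_allocation_fewer_ones_of_le {ι : Type*} [DecidableEq ι] {s : Finset ι} {a b : ι → ℝ}
    {k : ℕ} {x : ι → ℕ} (hx : IsAllocation s k x) {i j : ι} (hi : i ∈ s) (hj : j ∈ s)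
    (hij : i ≠ j) (hxi : x i = 1) (hxj : x j = 1) (h : a j ≤ b i) :
    ∃ y, IsAllocation s k y ∧ revenueOn s a b x ≤ revenueOn s a b y ∧
      (s.filter (y · = 1)).card < (s.filter (x · = 1)).card := by
  have hself : Function.update (Function.update x i 1) j 1 = x := by
    rw [← hxi, Function.update_eq_self, hxi, ← hxj, Function.update_eq_self]
  refine ⟨Function.update (Function.update x i 2) j 0, ⟨fun l hl => ?_, ?_⟩, ?_, ?_⟩
  · have := hx.1 l hl
    simp only [Function.update_apply]
    split_ifs <;> omega
  · have h1 := sum_update_pair s (fun _ m => m) x hi hj hij 1 1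
    have h2 := sum_update_pair s (fun _ m => m) x hi hj hij 2 0
    rw [hself, hx.2] at h1
    omega
  · have h1 := sum_update_pair s
      (fun l m => (if 1 ≤ m then a l else 0) + (if m = 2 then b l else 0)) x hi hj hij 1 1
    have h2 := sum_update_pair s
      (fun l m => (if 1 ≤ m then a l else 0) + (if m = 2 then b l else 0)) x hi hj hij 2 0
    rw [hself] at h1
    unfold revenueOn
    rw [h1, h2]
    norm_num
    linarith
  · refine Finset.card_lt_card (Finset.ssubset_iff_of_subset ?_ |>.2 ⟨i, ?_, ?_⟩)
    · intro l
      simp only [Finset.mem_filter, Function.update_apply]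
      split_ifs <;> simp +contextual
    · simp [hi, hxi]
    · simp [hij]

lemma exists_allocation_le_revenue_unique_one {ι : Type*} [DecidableEq ι] {s : Finset ι}
    {a b : ι → ℝ} (hab : ∀ i ∈ s, a i ≤ b i) {k : ℕ} (hk : Odd k) (x : ι → ℕ)
    (hx : IsAllocation s k x) :
    ∃ y, IsAllocation s k y ∧ revenueOn s a b x ≤ revenueOn s a b y ∧
      ∃! i, i ∈ s ∧ y i = 1 := by
  induction hc : (s.filter (x · = 1)).card using Nat.strong_induction_on generalizing x with
  | _ c ih =>
    by_cases hu : ∃! i, i ∈ s ∧ x i = 1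
    · exact ⟨x, hx, le_rfl, hu⟩
    obtain ⟨i, hi, hxi⟩ : ∃ i ∈ s, x i = 1 := by
      by_contra! hne
      refine Nat.not_even_iff_odd.2 hk (hx.2 ▸ Finset.even_sum _ fun i hi => ?_)
      have h2 := hx.1 i hi
      have h1 := hne i hi
      exact Nat.even_iff.2 (by omega)
    obtain ⟨j, hj, hxj, hij⟩ : ∃ j ∈ s, x j = 1 ∧ i ≠ j := by
      by_contra! hne
      exact hu ⟨i, ⟨hi, hxi⟩, fun j hj => (hne j hj.1 hj.2).symm⟩
    obtain ⟨y, hy, hxy, hlt⟩ : ∃ y, IsAllocation s k y ∧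
        revenueOn s a b x ≤ revenueOn s a b y ∧
        (s.filter (y · = 1)).card < (s.filter (x · = 1)).card := by
      rcases le_total (a j) (b i) with h | h
      · exact exists_allocation_fewer_ones_of_le hx hi hj hij hxi hxj h
      · exact exists_allocation_fewer_ones_of_le hx hj hi hij.symm hxj hxi
          ((hab i hi).trans (h.trans (hab j hj)))
    obtain ⟨z, hz, hyz, hzu⟩ := ih _ (hc ▸ hlt) y hy rfl
    exact ⟨z, hz, hxy.trans hyz, hzu⟩

lemma exists_isAllocation {ι : Type*} [DecidableEq ι] (s : Finset ι) {k : ℕ}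
    (hk : k ≤ 2 * s.card) : ∃ x, IsAllocation s k x := by
  induction k with
  | zero => exact ⟨0, by simp [IsAllocation]⟩
  | succ k ih =>
    obtain ⟨x, hx, hsum⟩ := ih (by omega)
    obtain ⟨i, hi, hlt⟩ : ∃ i ∈ s, x i < 2 := by
      by_contra! hne
      have : s.card * 2 ≤ ∑ i ∈ s, x i := Finset.card_nsmul_le_sum s x 2 hne
      omega
    refine ⟨Function.update x i (x i + 1), fun l hl => ?_, ?_⟩
    · have := hx l hl
      simp only [Function.update_apply]
      split_ifs <;> omega
    · rw [Finset.sum_update_of_mem hi, ← hsum, ← Finset.add_sum_erase s x hi,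
        Finset.sdiff_singleton_eq_erase]
      omega

lemma finite_revenueOn_image {ι : Type*} [DecidableEq ι] (s : Finset ι) (a b : ι → ℝ) (k : ℕ) :
    (revenueOn s a b '' {x | IsAllocation s k x}).Finite := by
  refine (Set.finite_range fun f : s → Fin 3 =>
    revenueOn s a b fun i => if h : i ∈ s then (f ⟨i, h⟩ : ℕ) else 0).subset ?_
  rintro _ ⟨x, hx, rfl⟩
  refine ⟨fun i => ⟨x i, Nat.lt_succ_of_le (hx.1 i i.2)⟩, ?_⟩
  refine Finset.sum_congr rfl fun i hi => ?_
  simp [hi]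

theorem exists_maximizer_with_unique_one
    (n : ℕ) (a b : ℕ → ℝ)
    (hab : ∀ i ∈ Finset.Icc 1 n, a i ≤ b i) :
    ∀ k : ℕ, Odd k → 1 ≤ k → k ≤ 2 * n - 1 →
      ∃ x : ℕ → ℕ, (∀ i ∈ Finset.Icc 1 n, x i ≤ 2) ∧
        (∑ i ∈ Finset.Icc 1 n, x i = k) ∧
        (∀ y : ℕ → ℕ, (∀ i ∈ Finset.Icc 1 n, y i ≤ 2) →
          (∑ i ∈ Finset.Icc 1 n, y i = k) → rev n a b y ≤ rev n a b x) ∧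
        (∃! i : ℕ, i ∈ Finset.Icc 1 n ∧ x i = 1) := by
  intro k hk hk1 hkn
  obtain ⟨x₀, hx₀⟩ := exists_isAllocation (Finset.Icc 1 n) (k := k) (by
    rw [Nat.card_Icc]
    omega)
  obtain ⟨_, ⟨x, hx, rfl⟩, hmax⟩ := Set.exists_max_image _ id
    (finite_revenueOn_image (Finset.Icc 1 n) a b k) ⟨_, x₀, hx₀, rfl⟩
  obtain ⟨z, hz, hxz, hzu⟩ := exists_allocation_le_revenue_unique_one hab hk x hx
  exact ⟨z, hz.1, hz.2, fun y hy hyk => (hmax _ ⟨y, ⟨hy, hyk⟩, rfl⟩).trans hxz, hzu⟩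
end

section
/- Let a_1, ..., a_n and b_1, ..., b_n be real numbers with a_i ≤ b_i for every i, and suppose the projects are sorted so that a_1 + b_1 ≥ a_2 + b_2 ≥ ... ≥ a_n + b_n. For 0 ≤ k ≤ 2n let g(k) be the maximum of Σ_{i : x_i ≥ 1} a_i + Σ_{i : x_i = 2} b_i over all vectors x ∈ {0,1,2}^n with Σ_i x_i = k. Then for every odd k = 2t+1 with 0 ≤ t ≤ n−1, g(2t+1) = max( g(2t) + max_{t+2 ≤ i ≤ n} a_i , g(2t+2) − min_{1 ≤ i ≤ t+1} b_i ), where the first term inside the outer max is omitted when t+2 > n. -/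
open Finset in
/-- If `T ⊆ S` collects indices of largest `a + b` (separated from the rest of `S` by `l`), then
no allocation of `2 * #T` efforts to `S` earns more than two efforts on each member of `T`. -/
theorem sum_revenue_le_sum_top (a b : ℕ → ℝ) (S T : Finset ℕ) (hTS : T ⊆ S) (l : ℝ)
    (hab : ∀ i ∈ S, a i ≤ b i) (hT : ∀ i ∈ T, l ≤ a i + b i)
    (hS : ∀ i ∈ S, i ∉ T → a i + b i ≤ l) (x : ℕ → ℕ) (hx : ∀ i ∈ S, x i ≤ 2)
    (hsum : ∑ i ∈ S, x i = 2 * #T) :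
    ∑ i ∈ S, ((if 1 ≤ x i then a i else 0) + (if x i = 2 then b i else 0)) ≤
      ∑ i ∈ T, (a i + b i) := by
  have pointwise : ∀ i ∈ S, ((if 1 ≤ x i then a i else 0) + (if x i = 2 then b i else 0)) ≤
      (x i : ℝ) * (l / 2) + (if i ∈ T then a i + b i - l else 0) := by
    intro i hi
    have h1 := hab i hi
    have h2 := hx i hi
    by_cases hiT : i ∈ T
    · have h3 := hT i hiT
      interval_cases h : x i <;> simp [hiT] <;> linarith
    · have h3 := hS i hi hiT
      interval_cases h : x i <;> simp [hiT] <;> linarith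
  have hsum' : (∑ i ∈ S, (x i : ℝ)) = 2 * #T := by exact_mod_cast hsum
  refine (sum_le_sum pointwise).trans (le_of_eq ?_)
  rw [sum_add_distrib, ← sum_mul, hsum', sum_ite_mem, inter_eq_right.mpr hTS, sum_sub_distrib,
    sum_const, nsmul_eq_mul]
  ring

open Finset in
theorem rev_two_on (n : ℕ) (a b : ℕ → ℝ) (T : Finset ℕ) (hT : T ⊆ Icc 1 n) :
    rev n a b (fun j => if j ∈ T then 2 else 0) = ∑ i ∈ T, (a i + b i) := by
  have h : ∀ j ∈ Icc 1 n, ((if 1 ≤ (if j ∈ T then 2 else 0) then a j else 0) +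
      (if (if j ∈ T then 2 else 0) = 2 then b j else 0)) = if j ∈ T then a j + b j else 0 := by
    intro j _
    by_cases hj : j ∈ T <;> simp [hj]
  rw [rev, sum_congr rfl h, sum_ite_mem, inter_eq_right.mpr hT]

open Finset in
theorem rev_two_on_one_at (n : ℕ) (a b : ℕ → ℝ) (T : Finset ℕ) (hT : T ⊆ Icc 1 n) (i : ℕ)
    (hi : i ∈ Icc 1 n) (hiT : i ∉ T) :
    rev n a b (fun j => (if j ∈ T then 2 else 0) + (if j = i then 1 else 0)) =
      ∑ i ∈ T, (a i + b i) + a i := by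
  have h : ∀ j ∈ Icc 1 n,
      ((if 1 ≤ (if j ∈ T then 2 else 0) + (if j = i then 1 else 0) then a j else 0) +
      (if (if j ∈ T then 2 else 0) + (if j = i then 1 else 0) = 2 then b j else 0)) =
      (if j ∈ T then a j + b j else 0) + if j = i then a j else 0 := by
    intro j _
    by_cases hji : j = i
    · subst hji
      simp [hiT]
    · by_cases hj : j ∈ T <;> simp [hj, hji]
  rw [rev, sum_congr rfl h, sum_add_distrib, sum_ite_mem, inter_eq_right.mpr hT, sum_ite_eq',
    if_pos hi]

theorem max_revenue_odd
    (n : ℕ) (a b : ℕ → ℝ) (g : ℕ → ℝ)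
    (hab : ∀ i ∈ Finset.Icc 1 n, a i ≤ b i)
    (hsort : ∀ i j : ℕ, 1 ≤ i → i ≤ j → j ≤ n → a j + b j ≤ a i + b i)
    (hg : ∀ k ≤ 2 * n,
      IsGreatest
        {r : ℝ | ∃ x : ℕ → ℕ, (∀ i ∈ Finset.Icc 1 n, x i ≤ 2) ∧
          (∑ i ∈ Finset.Icc 1 n, x i = k) ∧ r = rev n a b x}
        (g k))
    (t : ℕ) (ht : t + 1 ≤ n) :
    if h : t + 2 ≤ n then
      g (2 * t + 1) =
        max (g (2 * t) + (Finset.Icc (t + 2) n).sup' (Finset.nonempty_Icc.mpr h) a)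
          (g (2 * t + 2) -
            (Finset.Icc 1 (t + 1)).inf' (Finset.nonempty_Icc.mpr (by omega)) b)
    else
      g (2 * t + 1) =
        g (2 * t + 2) -
          (Finset.Icc 1 (t + 1)).inf' (Finset.nonempty_Icc.mpr (by omega)) b := by
  have even_value : ∀ s ≤ n, t ≤ s → s ≤ t + 1 →
      g (2 * s) = ∑ i ∈ Finset.Icc 1 s, (a i + b i) := by
    intro s hs hts hst
    have hsub : Finset.Icc 1 s ⊆ Finset.Icc 1 n := Finset.Icc_subset_Icc_right hs
    obtain ⟨⟨x, hx, hxs, hgx⟩, hub⟩ := hg (2 * s) (by omega)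
    apply le_antisymm
    · rw [hgx]
      refine sum_revenue_le_sum_top a b _ _ hsub (a (t + 1) + b (t + 1)) hab ?_ ?_ x hx
        (by simpa using hxs)
      · intro i hi
        rw [Finset.mem_Icc] at hi
        exact hsort i (t + 1) hi.1 (by omega) ht
      · intro i hi his
        rw [Finset.mem_Icc] at hi his
        exact hsort (t + 1) i (by omega) (by omega) hi.2
    · refine hub ⟨_, ?_, ?_, (rev_two_on n a b _ hsub).symm⟩
      · intro i _
        split_ifs <;> omega
      · rw [Finset.sum_ite_mem, Finset.inter_eq_right.mpr hsub]
        simp [mul_comm]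
  have h_low := even_value t (by omega) le_rfl (by omega)
  have h_high := even_value (t + 1) ht (by omega) le_rfl
  rw [show 2 * (t + 1) = 2 * t + 2 by ring] at h_high
  obtain ⟨⟨x, hx, hxs, hgx⟩, hub⟩ := hg (2 * t + 1) (by omega)
  have odd_lower : ∀ T ⊆ Finset.Icc 1 n, T.card = t → ∀ i ∈ Finset.Icc 1 n, i ∉ T →
      ∑ j ∈ T, (a j + b j) + a i ≤ g (2 * t + 1) := by
    intro T hT hcard i hi hiT
    refine hub ⟨_, ?_, ?_, (rev_two_on_one_at n a b T hT i hi hiT).symm⟩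
    · intro j _
      by_cases hji : j = i
      · subst hji
        simp [hiT]
      · by_cases hj : j ∈ T <;> simp [hj, hji]
    · rw [Finset.sum_add_distrib, Finset.sum_ite_mem, Finset.inter_eq_right.mpr hT,
        Finset.sum_ite_eq', if_pos hi, Finset.sum_const, hcard, smul_eq_mul, mul_comm]
  have odd_upper : ∃ i ∈ Finset.Icc 1 n, ∀ T ⊆ Finset.Icc 1 n, T.card = t → i ∉ T →
      (∀ j ∈ T, j ≤ t + 1) → (∀ j ∈ Finset.Icc 1 n, j ≠ i → j ∉ T → t + 1 ≤ j) →
      g (2 * t + 1) ≤ ∑ j ∈ T, (a j + b j) + a i := by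
    obtain ⟨i, hi, hxi⟩ : ∃ i ∈ Finset.Icc 1 n, x i = 1 := by
      by_contra! hne
      have hdvd : 2 ∣ ∑ i ∈ Finset.Icc 1 n, x i := Finset.dvd_sum fun i hi => by
        have h1 := hx i hi
        have h2 := hne i hi
        omega
      omega
    refine ⟨i, hi, fun T hT hcard hiT hle hge => ?_⟩
    rw [hgx, rev, ← Finset.sum_erase_add _ _ hi, hxi]
    rw [← Finset.sum_erase_add _ _ hi, hxi] at hxs
    have hbound := sum_revenue_le_sum_top a b ((Finset.Icc 1 n).erase i) T
      (Finset.subset_erase.mpr ⟨hT, hiT⟩) (a (t + 1) + b (t + 1))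
      (fun j hj => hab j (Finset.mem_of_mem_erase hj))
      (fun j hj => hsort j (t + 1) (Finset.mem_Icc.mp (hT hj)).1 (hle j hj) ht)
      (fun j hj hjT => by
        rw [Finset.mem_erase] at hj
        exact hsort (t + 1) j (by omega) (hge j hj.2 hj.1 hjT) (Finset.mem_Icc.mp hj.2).2)
      x (fun j hj => hx j (Finset.mem_of_mem_erase hj)) (by omega)
    simpa using hbound
  have sum_erase : ∀ i ∈ Finset.Icc 1 (t + 1),
      ∑ j ∈ (Finset.Icc 1 (t + 1)).erase i, (a j + b j) + a i = g (2 * t + 2) - b i := by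
    intro i hi
    rw [h_high, ← Finset.sum_erase_add _ _ hi]
    ring
  have card_erase : ∀ i ∈ Finset.Icc 1 (t + 1), ((Finset.Icc 1 (t + 1)).erase i).card = t := by
    intro i hi
    simp [Finset.card_erase_of_mem hi]
  have erase_subset : ∀ i, (Finset.Icc 1 (t + 1)).erase i ⊆ Finset.Icc 1 n := fun i =>
    (Finset.erase_subset _ _).trans (Finset.Icc_subset_Icc_right ht)
  have lower_high : g (2 * t + 2) -
      (Finset.Icc 1 (t + 1)).inf' (Finset.nonempty_Icc.mpr (by omega)) b ≤ g (2 * t + 1) := by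
    obtain ⟨i, hi, hbi⟩ := Finset.exists_mem_eq_inf'
      (Finset.nonempty_Icc.mpr (show 1 ≤ t + 1 by omega)) b
    rw [hbi, ← sum_erase i hi]
    exact odd_lower _ (erase_subset i) (card_erase i hi) i
      (Finset.Icc_subset_Icc_right ht hi) (Finset.notMem_erase _ _)
  obtain ⟨i, hi, hupper⟩ := odd_upper
  have upper_high : i ≤ t + 1 → g (2 * t + 1) ≤ g (2 * t + 2) -
      (Finset.Icc 1 (t + 1)).inf' (Finset.nonempty_Icc.mpr (by omega)) b := by
    intro hit
    have hi' : i ∈ Finset.Icc 1 (t + 1) := Finset.mem_Icc.mpr ⟨(Finset.mem_Icc.mp hi).1, hit⟩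
    have hinf := Finset.inf'_le b hi'
    have hbound := hupper _ (erase_subset i) (card_erase i hi') (Finset.notMem_erase _ _)
      (fun j hj => (Finset.mem_Icc.mp (Finset.mem_of_mem_erase hj)).2)
      (fun j hj hji hjT => by
        simp only [Finset.mem_erase, Finset.mem_Icc] at hj hjT
        omega)
    rw [sum_erase i hi'] at hbound
    linarith
  have hsub : Finset.Icc 1 t ⊆ Finset.Icc 1 n := Finset.Icc_subset_Icc_right (by omega)
  split_ifs with h
  · apply le_antisymm
    · by_cases hit : i ≤ t + 1
      · exact (upper_high hit).trans (le_max_right _ _)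
      · refine le_trans ?_ (le_max_left _ _)
        have hsup := Finset.le_sup' a
          (Finset.mem_Icc.mpr ⟨(by omega : t + 2 ≤ i), (Finset.mem_Icc.mp hi).2⟩)
        have hbound := hupper _ hsub (by simp) (by simp; omega)
          (fun j hj => by rw [Finset.mem_Icc] at hj; omega)
          (fun j hj _ hjT => by rw [Finset.mem_Icc] at hj hjT; omega)
        rw [h_low]
        linarith
    · refine max_le ?_ lower_high
      obtain ⟨j, hj, haj⟩ := Finset.exists_mem_eq_sup' (Finset.nonempty_Icc.mpr h) a
      rw [Finset.mem_Icc] at hj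
      rw [haj, h_low]
      exact odd_lower _ hsub (by simp) j (Finset.mem_Icc.mpr ⟨by omega, hj.2⟩)
        (by simp; omega)
  · exact le_antisymm (upper_high (by rw [Finset.mem_Icc] at hi; omega)) lower_high
end

section
/- Let a_1, ..., a_n and b_1, ..., b_n be real numbers with a_i ≤ b_i for every i, and suppose the projects are sorted so that a_1 + b_1 ≥ a_2 + b_2 ≥ ... ≥ a_n + b_n. For 0 ≤ k ≤ 2n let g(k) be the maximum of Σ_{i : x_i ≥ 1} a_i + Σ_{i : x_i = 2} b_i over all vectors x ∈ {0,1,2}^n with Σ_i x_i = k. Then g(2k+1) − g(2k) ≤ g(2k) − g(2k−1) for all 1 ≤ k ≤ n−1. -/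
/-- With nonincreasing values `a i + b i`, allocating `2` efforts to each of the first `k` projects
is optimal up to a correction that is linear in the total effort, with slope `(a k + b k) / 2`. -/
lemma rev_le_rev_initial_add (n : ℕ) (a b : ℕ → ℝ)
    (hab : ∀ i ∈ Finset.Icc 1 n, a i ≤ b i)
    (hsort : ∀ i j : ℕ, 1 ≤ i → i ≤ j → j ≤ n → a j + b j ≤ a i + b i)
    {k : ℕ} (hk : 1 ≤ k) (hkn : k ≤ n) (x : ℕ → ℕ) (hx : ∀ i ∈ Finset.Icc 1 n, x i ≤ 2) :
    rev n a b x ≤ rev n a b (fun i => if i ≤ k then 2 else 0) +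
      (((∑ i ∈ Finset.Icc 1 n, x i : ℕ) : ℝ) -
        ((∑ i ∈ Finset.Icc 1 n, if i ≤ k then 2 else 0 : ℕ) : ℝ)) * ((a k + b k) / 2) := by
  unfold rev
  rw [Nat.cast_sum, Nat.cast_sum, ← Finset.sum_sub_distrib, Finset.sum_mul,
    ← Finset.sum_add_distrib]
  refine Finset.sum_le_sum fun i hi => ?_
  have h_ab := hab i hi
  have h_x := hx i hi
  obtain ⟨h1, hn⟩ := Finset.mem_Icc.mp hi
  by_cases hik : i ≤ k
  · have h_c := hsort i k h1 hik hkn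
    interval_cases x i <;> simp [hik] <;> linarith
  · have h_c := hsort k i hk (by omega) hn
    interval_cases x i <;> simp [hik] <;> linarith

lemma sum_Icc_ite_le_two {n k : ℕ} (hkn : k ≤ n) :
    (∑ i ∈ Finset.Icc 1 n, if i ≤ k then 2 else 0) = 2 * k := by
  have h_filter : (Finset.Icc 1 n).filter (· ≤ k) = Finset.Icc 1 k := by
    ext i
    simp only [Finset.mem_filter, Finset.mem_Icc]
    omega
  rw [← Finset.sum_filter, h_filter]
  simp [mul_comm]

theorem max_revenue_property_three
    (n : ℕ) (a b : ℕ → ℝ) (g : ℕ → ℝ)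
    (hab : ∀ i ∈ Finset.Icc 1 n, a i ≤ b i)
    (hsort : ∀ i j : ℕ, 1 ≤ i → i ≤ j → j ≤ n → a j + b j ≤ a i + b i)
    (hg : ∀ k ≤ 2 * n,
      IsGreatest
        {r : ℝ | ∃ x : ℕ → ℕ, (∀ i ∈ Finset.Icc 1 n, x i ≤ 2) ∧
          (∑ i ∈ Finset.Icc 1 n, x i = k) ∧ r = rev n a b x}
        (g k)) :
    ∀ k : ℕ, 1 ≤ k → k + 1 ≤ n →
      g (2 * k + 1) - g (2 * k) ≤ g (2 * k) - g (2 * k - 1) := by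
  intro k hk hkn
  have hkn' : k ≤ n := by omega
  have h_sum := sum_Icc_ite_le_two hkn'
  have h_mid : rev n a b (fun i => if i ≤ k then 2 else 0) ≤ g (2 * k) :=
    (hg (2 * k) (by omega)).2 ⟨_, fun i _ => by split_ifs <;> omega, h_sum, rfl⟩
  obtain ⟨x, hx, hx_sum, hx_rev⟩ := (hg (2 * k + 1) (by omega)).1
  obtain ⟨y, hy, hy_sum, hy_rev⟩ := (hg (2 * k - 1) (by omega)).1
  have h_up := rev_le_rev_initial_add n a b hab hsort hk hkn' x hx
  have h_down := rev_le_rev_initial_add n a b hab hsort hk hkn' y hy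
  rw [hx_sum, h_sum, ← hx_rev] at h_up
  rw [hy_sum, h_sum, ← hy_rev, Nat.cast_sub (by omega)] at h_down
  push_cast at h_up h_down
  linarith
end

section
/- Let a_1, ..., a_n and b_1, ..., b_n be real numbers with a_i ≤ b_i for every i, and suppose the projects are sorted so that a_1 + b_1 ≥ a_2 + b_2 ≥ ... ≥ a_n + b_n. For 0 ≤ k ≤ 2n let g(k) be the maximum of Σ_{i : x_i ≥ 1} a_i + Σ_{i : x_i = 2} b_i over all vectors x ∈ {0,1,2}^n with Σ_i x_i = k. Then the sequence g(2k+1) − g(2k) is non-increasing in k; that is, g(2k−1) − g(2k−2) ≥ g(2k+1) − g(2k) for all 1 ≤ k ≤ n−1. -/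
/-- A revenue is achieved by funding the projects of `T` fully and those of `O` half. -/
theorem exists_rev_eq (n : ℕ) (a b : ℕ → ℝ) (T O : Finset ℕ)
    (hT : T ⊆ Finset.Icc 1 n) (hO : O ⊆ Finset.Icc 1 n) (hTO : Disjoint T O) :
    ∃ x : ℕ → ℕ, (∀ i ∈ Finset.Icc 1 n, x i ≤ 2) ∧
      (∑ i ∈ Finset.Icc 1 n, x i = 2 * T.card + O.card) ∧
      ∑ i ∈ T, (a i + b i) + ∑ i ∈ O, a i = rev n a b x := by
  refine ⟨fun i => (if i ∈ T then 2 else 0) + (if i ∈ O then 1 else 0), ?_, ?_, ?_⟩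
  · intro i _
    have : i ∈ T → i ∉ O := fun h => Finset.disjoint_left.mp hTO h
    grind
  · rw [Finset.sum_add_distrib, Finset.sum_ite_mem, Finset.sum_ite_mem,
      Finset.inter_eq_right.mpr hT, Finset.inter_eq_right.mpr hO]
    simp [mul_comm]
  · rw [← Finset.inter_eq_right.mpr hT, ← Finset.inter_eq_right.mpr hO,
      ← Finset.sum_ite_mem, ← Finset.sum_ite_mem, ← Finset.sum_add_distrib, rev,
      Finset.inter_eq_right.mpr hT, Finset.inter_eq_right.mpr hO]
    refine Finset.sum_congr rfl fun i _ => ?_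
    have : i ∈ T → i ∉ O := fun h => Finset.disjoint_left.mp hTO h
    by_cases h1 : i ∈ T <;> by_cases h2 : i ∈ O <;> simp_all

/-- If `T` consists of the projects outside `O` whose full revenue is above a threshold `l`, then
no allocation that half funds `O` and spends `2 * T.card` elsewhere beats fully funding `T`. -/
theorem rev_le_of_threshold (n : ℕ) (a b : ℕ → ℝ) (hab : ∀ i ∈ Finset.Icc 1 n, a i ≤ b i)
    (T O : Finset ℕ) (hO : O ⊆ Finset.Icc 1 n) (hT : T ⊆ Finset.Icc 1 n \ O) (l : ℝ)
    (hl : ∀ i ∈ T, l ≤ a i + b i) (hu : ∀ i ∈ Finset.Icc 1 n \ O, i ∉ T → a i + b i ≤ l)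
    (x : ℕ → ℕ) (hx : ∀ i ∈ Finset.Icc 1 n, x i ≤ 2) (hxO : ∀ i ∈ O, x i = 1)
    (hs : ∑ i ∈ Finset.Icc 1 n, x i = 2 * T.card + O.card) :
    rev n a b x ≤ ∑ i ∈ T, (a i + b i) + ∑ i ∈ O, a i := by
  rw [rev, ← Finset.sum_sdiff hO]
  rw [← Finset.sum_sdiff hO, Finset.sum_congr rfl hxO] at hs
  have hs' : ∑ i ∈ Finset.Icc 1 n \ O, x i = 2 * T.card := by simpa using hs
  have hsR : ∑ i ∈ Finset.Icc 1 n \ O, (x i : ℝ) = 2 * T.card := by exact_mod_cast hs'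
  have hone : ∑ i ∈ O, ((if 1 ≤ x i then a i else 0) + (if x i = 2 then b i else 0))
      = ∑ i ∈ O, a i := Finset.sum_congr rfl fun i hi => by simp [hxO i hi]
  rw [hone]
  gcongr
  have hpt : ∀ i ∈ Finset.Icc 1 n \ O,
      ((if 1 ≤ x i then a i else 0) + (if x i = 2 then b i else 0))
        ≤ (if i ∈ T then a i + b i - l else 0) + l / 2 * x i := by
    intro i hi
    have hiI := (Finset.mem_sdiff.mp hi).1
    have h1 := hab i hiI
    have h2 := hx i hiI
    have h3 := hl i
    have h4 := hu i hi
    by_cases hiT : i ∈ T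
    · have h5 := h3 hiT
      interval_cases x i <;> simp [hiT] <;> linarith
    · have h5 := h4 hiT
      interval_cases x i <;> simp [hiT] <;> linarith
  calc _ ≤ _ := Finset.sum_le_sum hpt
    _ = _ := by
      rw [Finset.sum_add_distrib, ← Finset.mul_sum, hsR, Finset.sum_ite_mem,
        Finset.inter_eq_right.mpr hT, Finset.sum_sub_distrib]
      simp
      ring

theorem max_revenue_property_four
    (n : ℕ) (a b : ℕ → ℝ) (g : ℕ → ℝ)
    (hab : ∀ i ∈ Finset.Icc 1 n, a i ≤ b i)
    (hsort : ∀ i j : ℕ, 1 ≤ i → i ≤ j → j ≤ n → a j + b j ≤ a i + b i)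
    (hg : ∀ k ≤ 2 * n,
      IsGreatest
        {r : ℝ | ∃ x : ℕ → ℕ, (∀ i ∈ Finset.Icc 1 n, x i ≤ 2) ∧
          (∑ i ∈ Finset.Icc 1 n, x i = k) ∧ r = rev n a b x}
        (g k)) :
    ∀ k : ℕ, 1 ≤ k → k + 1 ≤ n →
      g (2 * k + 1) - g (2 * k) ≤ g (2 * k - 1) - g (2 * k - 2) := by
  intro k hk hkn
  have hS : ∑ i ∈ Finset.Icc 1 k, (a i + b i)
      = ∑ i ∈ Finset.Icc 1 (k - 1), (a i + b i) + (a k + b k) := by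
    obtain ⟨m, rfl⟩ : ∃ m, k = m + 1 := ⟨k - 1, by omega⟩
    exact Finset.sum_Icc_succ_top (by omega) _
  have heven : ∑ i ∈ Finset.Icc 1 k, (a i + b i) ≤ g (2 * k) := by
    obtain ⟨x, hx, hsum, hrev⟩ := exists_rev_eq n a b (Finset.Icc 1 k) ∅
      (Finset.Icc_subset_Icc_right (by omega)) (by simp) (by simp)
    exact (hg (2 * k) (by omega)).2 ⟨x, hx, by simpa using hsum, by simpa using hrev⟩
  have hprev : g (2 * k - 2) ≤ ∑ i ∈ Finset.Icc 1 (k - 1), (a i + b i) := by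
    obtain ⟨x, hx, hsum, hrev⟩ := (hg (2 * k - 2) (by omega)).1
    rw [hrev]
    have := rev_le_of_threshold n a b hab (Finset.Icc 1 (k - 1)) ∅ (by simp)
      (by intro i; simp; omega) (a k + b k)
      (fun i hi => by simp at hi; exact hsort i k (by omega) (by omega) (by omega))
      (fun i hi hi' => by simp at hi hi'; exact hsort k i (by omega) (by omega) (by omega))
      x hx (by simp) (by simp [hsum]; omega)
    simpa using this
  suffices h : g (2 * k + 1) ≤ g (2 * k - 1) + (a k + b k) by linarith
  obtain ⟨x, hx, hsum, hrev⟩ := (hg (2 * k + 1) (by omega)).1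
  obtain ⟨i, hi, hxi⟩ : ∃ i ∈ Finset.Icc 1 n, x i = 1 := by
    by_contra! hne
    have : 2 ∣ ∑ i ∈ Finset.Icc 1 n, x i := Finset.dvd_sum fun i hi => by
      have := hx i hi
      have := hne i hi
      omega
    omega
  have hi' := Finset.mem_Icc.mp hi
  rw [hrev]
  rcases lt_or_ge k i with hki | hik
  · have hub := rev_le_of_threshold n a b hab (Finset.Icc 1 k) {i} (by simpa using hi)
      (by intro j; simp; omega) (a k + b k)
      (fun j hj => by simp at hj; exact hsort j k (by omega) (by omega) (by omega))
      (fun j hj hj' => by simp at hj hj'; exact hsort k j (by omega) (by omega) (by omega))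
      x hx (by simpa using hxi) (by simp [hsum])
    obtain ⟨y, hy, hysum, hyrev⟩ := exists_rev_eq n a b (Finset.Icc 1 (k - 1)) {i}
      (Finset.Icc_subset_Icc_right (by omega)) (by simpa using hi) (by simp; omega)
    have hlb := (hg (2 * k - 1) (by omega)).2 ⟨y, hy, by simp at hysum; omega, hyrev⟩
    linarith
  · have hmem : ∀ m, k ≤ m → i ∈ Finset.Icc 1 m := fun m hm => by simp; omega
    have hub := rev_le_of_threshold n a b hab ((Finset.Icc 1 (k + 1)).erase i) {i}
      (by simpa using hi) (by intro j; simp; omega) (a (k + 1) + b (k + 1))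
      (fun j hj => by simp at hj; exact hsort j (k + 1) (by omega) (by omega) (by omega))
      (fun j hj hj' => by simp at hj hj'; exact hsort (k + 1) j (by omega) (by omega) (by omega))
      x hx (by simpa using hxi)
      (by rw [Finset.card_erase_of_mem (hmem _ (by omega))]; simp [hsum])
    obtain ⟨y, hy, hysum, hyrev⟩ := exists_rev_eq n a b ((Finset.Icc 1 k).erase i) {i}
      ((Finset.erase_subset _ _).trans (Finset.Icc_subset_Icc_right (by omega)))
      (by simpa using hi) (by simp)
    rw [Finset.card_erase_of_mem (hmem _ le_rfl)] at hysum
    have hlb := (hg (2 * k - 1) (by omega)).2 ⟨y, hy, by simp at hysum; omega, hyrev⟩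
    have e1 := Finset.sum_erase_add _ (fun j => a j + b j) (hmem k le_rfl)
    have e2 := Finset.sum_erase_add _ (fun j => a j + b j) (hmem (k + 1) (by omega))
    rw [Finset.sum_Icc_succ_top (by omega)] at e2
    have hkk := hsort k (k + 1) hk (by omega) hkn
    linarith
end
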